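/- arXiv:2111.07595 — 2 statements merged into one kernel-verified Lean document; each statement's English description precedes it below -/
import Mathlib

section
/- Let n > 1 be an odd positive integer, let M = (n-1)/2 or M = n-1, and let a, b be indeterminates. Then Σ_{k=0}^{M} [6k+1]·(aq,q/a;q²)_k·(q²,bq,q/b;q⁴)_k / ((q⁴,q⁴/a,aq⁴;q⁴)_k·(q²/b,bq²;q²)_k) · q^{2k} ≡ 0 modulo [n]. -/
/-- The q-shifted factorial `(x;q)_k = (1-x)(1-xq)⋯(1-xq^{k-1})`. -/
def qPoch {K : Type*} [Field K] (x q : K) (k : ℕ) : K :=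
  ∏ i ∈ Finset.range k, (1 - x * q ^ i)

/-- The q-integer `[r] = 1 + q + ⋯ + q^{r-1}`. -/
def qint {K : Type*} [Field K] (q : K) (r : ℕ) : K :=
  ∑ i ∈ Finset.range r, q ^ i

/-- The field ℚ(a,b) of rational functions in two indeterminates over ℚ. -/
abbrev Qab : Type := FractionRing (MvPolynomial (Fin 2) ℚ)

/-- The indeterminate `a` in ℚ(a,b), viewed inside the rational function field in `q`. -/
noncomputable def aa : RatFunc Qab :=
  RatFunc.C (algebraMap (MvPolynomial (Fin 2) ℚ) Qab (MvPolynomial.X 0))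

/-- The indeterminate `b` in ℚ(a,b), viewed inside the rational function field in `q`. -/
noncomputable def bb : RatFunc Qab :=
  RatFunc.C (algebraMap (MvPolynomial (Fin 2) ℚ) Qab (MvPolynomial.X 1))

section Quadratic

variable {K : Type*} [Field K]

lemma qPoch_zero (x q : K) : qPoch x q 0 = 1 := by simp [qPoch]

lemma qPoch_succ (x q : K) (k : ℕ) : qPoch x q (k + 1) = qPoch x q k * (1 - x * q ^ k) := by
  simp [qPoch, Finset.prod_range_succ]

lemma qPoch_succ_left (x q : K) (k : ℕ) :
    qPoch x q (k + 1) = (1 - x) * qPoch (x * q) q k := by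
  simp only [qPoch, Finset.prod_range_succ', pow_zero, mul_one]
  rw [mul_comm]
  congr 1
  exact Finset.prod_congr rfl fun i _ => by ring

lemma qPoch_ne_zero {x q : K} {k : ℕ} (h : ∀ i < k, 1 - x * q ^ i ≠ 0) : qPoch x q k ≠ 0 :=
  Finset.prod_ne_zero_iff.2 fun i hi => h i (Finset.mem_range.1 hi)

/-- The summand of the terminating case of the Gasper–Rahman quadratic summation, in base `p`. -/
def quadTerm (a b p u w : K) (k : ℕ) : K :=
  (1 - a * (p ^ k) ^ 3) * p ^ k *
    (qPoch a p k * qPoch b p k * qPoch (p / b) p k) *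
    (qPoch (u * w * p) (p ^ 2) k * qPoch (a / (u * p)) (p ^ 2) k * qPoch (a * p / w) (p ^ 2) k) /
    ((qPoch (p ^ 2) (p ^ 2) k * qPoch (a * p ^ 2 / b) (p ^ 2) k * qPoch (a * b * p) (p ^ 2) k) *
      (qPoch (a / (u * w)) p k * qPoch (u * p ^ 2) p k * qPoch w p k))

/-- The part of the summand which is common to `quadTerm a b p u w` and `quadTerm a b p w u`. -/
def quadCommon (a b p u w : K) (k : ℕ) : K :=
  (qPoch a p k * qPoch b p k * qPoch (p / b) p k * qPoch (u * w * p) (p ^ 2) k) /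
    ((qPoch (p ^ 2) (p ^ 2) k * qPoch (a * p ^ 2 / b) (p ^ 2) k * qPoch (a * b * p) (p ^ 2) k) *
      (qPoch (a / (u * w)) p k * qPoch u p k * qPoch w p k))

/-- The telescoping certificate for the recurrence of the quadratic sum. -/
def quadCert (a b p u w : K) (k : ℕ) : K :=
  quadCommon a b p u w k * qPoch (a * p / u) (p ^ 2) k * qPoch (a * p / w) (p ^ 2) k *
    ((1 - a * p ^ k) * (1 - b * p ^ k) * (1 - p / b * p ^ k) * (1 - u * w * p * (p ^ k) ^ 2)) /
    ((1 - u * p ^ k) * (1 - u * p * p ^ k) * (1 - w * p ^ k) * (1 - w * p * p ^ k))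

lemma quad_identity {a b p u w : K} (x : K) (hb : b ≠ 0) (hp : p ≠ 0) (hu : u ≠ 0) (hw : w ≠ 0) :
    (1 - a * x ^ 3) * x *
      ((1 - a / (w * p)) * (1 - a * x ^ 2 / (u * p)) * ((1 - b * w) * (1 - w * p / b)) *
          ((1 - u * x) * (1 - u * p * x)) -
        (1 - a / (u * p)) * (1 - a * x ^ 2 / (w * p)) * ((1 - b * u) * (1 - u * p / b)) *
          ((1 - w * x) * (1 - w * p * x))) =
    (w - u) *
      ((1 - a * x ^ 2 / (u * p)) * (1 - a * x ^ 2 / (w * p)) *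
          ((1 - a * x) * (1 - b * x) * (1 - p * x / b) * (1 - u * w * p * x ^ 2)) -
        (1 - x ^ 2) * (1 - a * x ^ 2 / b) * (1 - a * b * x ^ 2 / p) * (1 - a * x / (u * w * p)) *
          ((1 - u * p * x) * (1 - w * p * x))) := by
  field_simp
  ring

end Quadratic

section QuadraticSum

variable {K : Type*} [Field K]

lemma quadTerm_eq (a b p u w : K) (k : ℕ) (h : (1 - u) * (1 - u * p) ≠ 0) :
    quadTerm a b p u w k = (1 - a * (p ^ k) ^ 3) * p ^ k * quadCommon a b p u w k *
      (qPoch (a / (u * p)) (p ^ 2) k * qPoch (a * p / w) (p ^ 2) k) *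
      ((1 - u) * (1 - u * p)) / ((1 - u * p ^ k) * (1 - u * p * p ^ k)) := by
  have hs : qPoch (u * p ^ 2) p k =
      qPoch u p k * ((1 - u * p ^ k) * (1 - u * p * p ^ k)) / ((1 - u) * (1 - u * p)) := by
    rw [eq_div_iff h]
    have h1 := qPoch_succ u p k
    have h2 := qPoch_succ u p (k + 1)
    have h3 := qPoch_succ_left u p (k + 1)
    have h4 := qPoch_succ_left (u * p) p k
    rw [h3, h4, h1] at h2
    rw [show u * p ^ 2 = u * p * p by ring]
    linear_combination h2
  rw [quadTerm, quadCommon, hs]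
  simp only [div_eq_mul_inv, mul_inv, inv_inv]
  ring

lemma quadCommon_comm (a b p u w : K) (k : ℕ) :
    quadCommon a b p u w k = quadCommon a b p w u k := by
  simp only [quadCommon, mul_comm u w]
  ring

lemma quadCommon_succ (a b p u w : K) (k : ℕ) :
    quadCommon a b p u w (k + 1) = quadCommon a b p u w k *
      (((1 - a * p ^ k) * (1 - b * p ^ k) * (1 - p / b * p ^ k) * (1 - u * w * p * (p ^ k) ^ 2)) /
        (((1 - (p * p ^ k) ^ 2) * (1 - a * (p * p ^ k) ^ 2 / b) * (1 - a * b * p * (p ^ k) ^ 2)) *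
          ((1 - a / (u * w) * p ^ k) * (1 - u * p ^ k) * (1 - w * p ^ k)))) := by
  rw [quadCommon, quadCommon, div_mul_div_comm]
  simp only [qPoch_succ]
  congr 1 <;> ring

/-- Telescoping of the difference of the two quadratic summands. -/
lemma quadTerm_sub_telescope {a b p u w : K} (hb : b ≠ 0) (hp : p ≠ 0) (hu : u ≠ 0) (hw : w ≠ 0)
    (hpk : ∀ k, 1 - (p * p ^ k) ^ 2 ≠ 0) (h1 : ∀ k, 1 - a * (p * p ^ k) ^ 2 / b ≠ 0)
    (h2 : ∀ k, 1 - a * b * p * (p ^ k) ^ 2 ≠ 0) (h3 : ∀ k, 1 - a / (u * w) * p ^ k ≠ 0)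
    (hu' : ∀ k, 1 - u * p ^ k ≠ 0) (hw' : ∀ k, 1 - w * p ^ k ≠ 0) (n : ℕ) :
    ∑ k ∈ Finset.range (n + 1),
      ((1 - b * w) * (1 - w * p / b) / ((1 - w) * (1 - w * p)) * quadTerm a b p w u k -
        (1 - b * u) * (1 - u * p / b) / ((1 - u) * (1 - u * p)) * quadTerm a b p u w k) =
      (w - u) * quadCert a b p u w n := by
  have hu2 : ∀ k, 1 - u * p * p ^ k ≠ 0 := fun k => by
    have := hu' (k + 1); rwa [pow_succ', ← mul_assoc] at this
  have hw2 : ∀ k, 1 - w * p * p ^ k ≠ 0 := fun k => by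
    have := hw' (k + 1); rwa [pow_succ', ← mul_assoc] at this
  have e1 := hu' 0
  have e2 := hu2 0
  have e3 := hw' 0
  have e4 := hw2 0
  simp only [pow_zero, mul_one] at e1 e2 e3 e4
  have key : ∀ k, (1 - b * w) * (1 - w * p / b) / ((1 - w) * (1 - w * p)) * quadTerm a b p w u k -
        (1 - b * u) * (1 - u * p / b) / ((1 - u) * (1 - u * p)) * quadTerm a b p u w k =
      (1 - a * (p ^ k) ^ 3) * p ^ k * quadCommon a b p u w k *
        (qPoch (a / (w * p)) (p ^ 2) k * qPoch (a * p / u) (p ^ 2) k *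
            ((1 - b * w) * (1 - w * p / b)) / ((1 - w * p ^ k) * (1 - w * p * p ^ k)) -
          qPoch (a / (u * p)) (p ^ 2) k * qPoch (a * p / w) (p ^ 2) k *
            ((1 - b * u) * (1 - u * p / b)) / ((1 - u * p ^ k) * (1 - u * p * p ^ k))) := by
    intro k
    rw [quadTerm_eq a b p u w k (mul_ne_zero e1 e2),
      quadTerm_eq a b p w u k (mul_ne_zero e3 e4),
      quadCommon_comm a b p w u]
    generalize quadCommon a b p u w k = Z
    have := hu' k
    have := hu2 k
    have := hw' k
    have := hw2 k
    generalize 1 - b * w = c1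
    generalize 1 - b * u = c2
    generalize 1 - w * p / b = c3
    generalize 1 - u * p / b = c4
    generalize 1 - u * p ^ k = d1 at *
    generalize 1 - u * p * p ^ k = d2 at *
    generalize 1 - w * p ^ k = d3 at *
    generalize 1 - w * p * p ^ k = d4 at *
    generalize 1 - u = d5 at *
    generalize 1 - u * p = d6 at *
    generalize 1 - w = d7 at *
    generalize 1 - w * p = d8 at *
    field_simp
  induction n with
  | zero =>
    rw [zero_add, Finset.sum_range_one, key]
    have := quad_identity (a := a) 1 hb hp hu hw
    simp only [quadCert, quadCommon, qPoch_zero, pow_zero, mul_one, one_pow, one_mul, div_one]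
    rw [div_sub_div _ _ (mul_ne_zero e3 e4) (mul_ne_zero e1 e2)]
    field_simp
    ring
  | succ n ih =>
    have hx : p ^ (n + 1) = p * p ^ n := pow_succ' p n
    have f5 := hu2 (n + 1)
    have f6 := hw2 (n + 1)
    have f2 := hu' (n + 1)
    have f4 := hw' (n + 1)
    have s1 : ∀ x : K, x ≠ 0 → qPoch (a / (x * p)) (p ^ 2) (n + 1) =
        (1 - a / (x * p)) * qPoch (a * p / x) (p ^ 2) n := fun x hx => by
      rw [qPoch_succ_left]
      congr 2
      field_simp
    have s2 : ∀ x : K, x ≠ 0 → qPoch (a * p / x) (p ^ 2) (n + 1) =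
        qPoch (a * p / x) (p ^ 2) n * (1 - a * (p * p ^ n) ^ 2 / (x * p)) := fun x hx => by
      rw [qPoch_succ]
      congr 2
      field_simp
      ring
    have hcert : quadCert a b p u w n = quadCommon a b p u w (n + 1) *
        qPoch (a * p / u) (p ^ 2) n * qPoch (a * p / w) (p ^ 2) n *
        ((1 - (p * p ^ n) ^ 2) * (1 - a * (p * p ^ n) ^ 2 / b) *
          (1 - a * b * (p * p ^ n) ^ 2 / p) * (1 - a * (p * p ^ n) / (u * w * p))) /
        ((1 - u * (p * p ^ n)) * (1 - w * (p * p ^ n))) := by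
      rw [show a * b * (p * p ^ n) ^ 2 / p = a * b * p * (p ^ n) ^ 2 by field_simp,
        show a * (p * p ^ n) / (u * w * p) = a / (u * w) * p ^ n by field_simp,
        show u * (p * p ^ n) = u * p * p ^ n by ring, show w * (p * p ^ n) = w * p * p ^ n by ring,
        quadCommon_succ, quadCert]
      have f1 := hu' n
      have f2 := hu2 n
      have f3 := hw' n
      have f4 := hw2 n
      have g1 := hpk n
      have g2 := h1 n
      have g3 := h2 n
      have g4 := h3 n
      generalize 1 - u * p ^ n = d1 at *
      generalize 1 - u * p * p ^ n = d2 at *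
      generalize 1 - w * p ^ n = d3 at *
      generalize 1 - w * p * p ^ n = d4 at *
      generalize 1 - (p * p ^ n) ^ 2 = d5 at *
      generalize 1 - a * (p * p ^ n) ^ 2 / b = d6 at *
      generalize 1 - a * b * p * (p ^ n) ^ 2 = d7 at *
      generalize 1 - a / (u * w) * p ^ n = d8 at *
      field_simp
    rw [Finset.sum_range_succ, ih, key, hcert, quadCert, s1 w hw, s1 u hu, s2 u hu, s2 w hw]
    have id := quad_identity (a := a) (p ^ (n + 1)) hb hp hu hw
    rw [show p / b * p ^ (n + 1) = p * p ^ (n + 1) / b by ring]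
    rw [← hx]
    generalize quadCommon a b p u w (n + 1) = Z at *
    generalize qPoch (a * p / u) (p ^ 2) n = Bu at *
    generalize qPoch (a * p / w) (p ^ 2) n = Bw at *
    generalize p ^ (n + 1) = x at *
    generalize 1 - u * p * x = d2 at *
    generalize 1 - u * x = d1 at *
    generalize 1 - w * p * x = d4 at *
    generalize 1 - w * x = d3 at *
    generalize 1 - a * x ^ 2 / (u * p) = c1 at *
    generalize 1 - a * x ^ 2 / (w * p) = c2 at *
    generalize 1 - a / (u * p) = c3 at *
    generalize 1 - a / (w * p) = c4 at *
    generalize 1 - b * w = c5 at *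
    generalize 1 - b * u = c6 at *
    generalize 1 - w * p / b = c7 at *
    generalize 1 - u * p / b = c8 at *
    generalize 1 - p * x / b = c9 at *
    generalize 1 - a * x ^ 2 / b = c10 at *
    generalize 1 - a * b * x ^ 2 / p = c11 at *
    generalize 1 - a * x / (u * w * p) = c12 at *
    field_simp
    linear_combination Z * Bu * Bw * id

/-- The recurrence in `n` for the terminating quadratic sum, where `w = a p ^ (2 n + 1)`. -/
lemma sum_quadTerm_swap {a b p u w : K} (n : ℕ) (hw : w = a * p ^ (2 * n + 1)) (ha : a ≠ 0)
    (hb : b ≠ 0) (hp : p ≠ 0) (hu : u ≠ 0)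
    (hpk : ∀ k, 1 - (p * p ^ k) ^ 2 ≠ 0) (h1 : ∀ k, 1 - a * (p * p ^ k) ^ 2 / b ≠ 0)
    (h2 : ∀ k, 1 - a * b * p * (p ^ k) ^ 2 ≠ 0) (h3 : ∀ k, 1 - a / (u * w) * p ^ k ≠ 0)
    (hu' : ∀ k, 1 - u * p ^ k ≠ 0) (hw' : ∀ k, 1 - w * p ^ k ≠ 0) :
    (1 - b * w) * (1 - w * p / b) / ((1 - w) * (1 - w * p)) *
        ∑ k ∈ Finset.range (n + 2), quadTerm a b p w u k =
      (1 - b * u) * (1 - u * p / b) / ((1 - u) * (1 - u * p)) *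
        ∑ k ∈ Finset.range (n + 1), quadTerm a b p u w k := by
  have hw0 : w ≠ 0 := by rw [hw]; exact mul_ne_zero ha (pow_ne_zero _ hp)
  have ht := quadTerm_sub_telescope hb hp hu hw0 hpk h1 h2 h3 hu' hw' (n + 1)
  have z : qPoch (a * p / w) (p ^ 2) (n + 1) = 0 := by
    refine Finset.prod_eq_zero (Finset.mem_range.2 n.lt_succ_self) ?_
    rw [hw]
    field_simp
    ring
  rw [quadCert, z] at ht
  have zt : quadTerm a b p u w (n + 1) = 0 := by simp [quadTerm, z]
  rw [Finset.sum_sub_distrib, ← Finset.mul_sum, ← Finset.mul_sum,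
    Finset.sum_range_succ (fun k => quadTerm a b p u w k), zt] at ht
  simpa [sub_eq_zero] using ht

lemma quadTerm_shift {a b p u w : K} (hp : p ≠ 0) (hu : u ≠ 0) (hw : w ≠ 0) (k : ℕ) :
    quadTerm a b p (u / p ^ 2) (w * p ^ 2) k = quadTerm a b p w u k := by
  have e1 : u / p ^ 2 * (w * p ^ 2) = w * u := by field_simp
  have e2 : a / (u / p ^ 2 * p) = a * p / u := by field_simp
  have e3 : a * p / (w * p ^ 2) = a / (w * p) := by field_simp
  have e4 : u / p ^ 2 * p ^ 2 = u := by field_simp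
  rw [quadTerm, quadTerm, e1, e2, e3, e4]
  ring

/-- A terminating case of the Gasper–Rahman quadratic summation. -/
theorem sum_quadTerm {a b d p : K} (ha : a ≠ 0) (hb : b ≠ 0) (hd : d ≠ 0) (hp : p ≠ 0)
    (hpk : ∀ k, 1 - (p * p ^ k) ^ 2 ≠ 0) (h1 : ∀ k, 1 - a * (p * p ^ k) ^ 2 / b ≠ 0)
    (h2 : ∀ k, 1 - a * b * p * (p ^ k) ^ 2 ≠ 0) (h3 : ∀ k, 1 - a * p / d * p ^ k ≠ 0)
    (hu : ∀ i k, 1 - d / (a * p ^ (2 * i + 2)) * p ^ k ≠ 0)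
    (hw : ∀ i k, 1 - a * p ^ (2 * i + 1) * p ^ k ≠ 0)
    (hbw : ∀ k, 1 - b * (a * p ^ k) ≠ 0) (hwb : ∀ k, 1 - a * p ^ k / b ≠ 0) (n : ℕ) :
    ∑ k ∈ Finset.range (n + 1),
        quadTerm a b p (d / (a * p ^ (2 * n + 2))) (a * p ^ (2 * n + 1)) k =
      (1 - a) * ∏ i ∈ Finset.range n,
        ((1 - a * p ^ (2 * i + 1)) * (1 - a * p ^ (2 * i + 2)) *
          ((1 - b * (d / (a * p ^ (2 * i + 2)))) * (1 - d / (a * p ^ (2 * i + 2)) * p / b)) /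
          ((1 - d / (a * p ^ (2 * i + 2))) * (1 - d / (a * p ^ (2 * i + 2)) * p) *
            ((1 - b * (a * p ^ (2 * i + 1))) * (1 - a * p ^ (2 * i + 2) / b)))) := by
  induction n with
  | zero => simp [quadTerm, qPoch_zero]
  | succ n ih =>
    have hu0 : d / (a * p ^ (2 * n + 2)) ≠ 0 :=
      div_ne_zero hd (mul_ne_zero ha (pow_ne_zero _ hp))
    have hsw := sum_quadTerm_swap (a := a) (b := b) (p := p) (u := d / (a * p ^ (2 * n + 2))) n rfl
      ha hb hp hu0 hpk h1 h2
      (fun k => by convert h3 k using 3; field_simp; ring) (hu n) (hw n)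
    rw [Finset.prod_range_succ, ← mul_assoc, ← ih]
    have e : ∀ k, quadTerm a b p (d / (a * p ^ (2 * (n + 1) + 2))) (a * p ^ (2 * (n + 1) + 1)) k =
        quadTerm a b p (a * p ^ (2 * n + 1)) (d / (a * p ^ (2 * n + 2))) k := fun k => by
      rw [← quadTerm_shift hp hu0 (mul_ne_zero ha (pow_ne_zero _ hp))]
      congr 1
      · field_simp
        ring
      · ring
    simp only [e]
    have g1 := hw n 0
    have g2 := hw n 1
    have g3 := hbw (2 * n + 1)
    have g4 := hwb (2 * n + 2)
    have g5 := hu n 0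
    have g6 := hu n 1
    simp only [pow_zero, pow_one, mul_one] at g1 g2 g5 g6
    have e2 : a * p ^ (2 * n + 1) * p = a * p ^ (2 * n + 2) := by ring
    rw [e2] at g2 hsw
    generalize ∑ k ∈ Finset.range (n + 2),
      quadTerm a b p (a * p ^ (2 * n + 1)) (d / (a * p ^ (2 * n + 2))) k = S at *
    generalize ∑ k ∈ Finset.range (n + 1),
      quadTerm a b p (d / (a * p ^ (2 * n + 2))) (a * p ^ (2 * n + 1)) k = S' at *
    generalize 1 - a * p ^ (2 * n + 1) = d1 at *
    generalize 1 - a * p ^ (2 * n + 2) = d2 at *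
    generalize 1 - b * (a * p ^ (2 * n + 1)) = d3 at *
    generalize 1 - a * p ^ (2 * n + 2) / b = d4 at *
    generalize 1 - d / (a * p ^ (2 * n + 2)) * p = d6 at *
    generalize 1 - d / (a * p ^ (2 * n + 2)) = d5 at *
    generalize 1 - b * (d / (a * p ^ (2 * n + 2))) = c1 at *
    generalize 1 - d / (a * p ^ (2 * n + 2)) * p / b = c2 at *
    field_simp at hsw ⊢
    linear_combination hsw

end QuadraticSum

section Value

open Polynomial

variable {F L : Type*} [Field F] [Field L] [Algebra F L]

/-- The rational function `f` is regular at `ζ`, with value `v` there. -/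
def HasValue (ζ : L) (f : RatFunc F) (v : L) : Prop :=
  ∃ P S : F[X], aeval ζ S ≠ 0 ∧ f * algebraMap F[X] (RatFunc F) S = algebraMap F[X] (RatFunc F) P ∧
    v * aeval ζ S = aeval ζ P

namespace HasValue

variable {ζ : L} {f g : RatFunc F} {v w : L}

lemma X : HasValue ζ (RatFunc.X : RatFunc F) ζ :=
  ⟨Polynomial.X, 1, by simp, by simp, by simp⟩

lemma C (c : F) : HasValue ζ (RatFunc.C c) (algebraMap F L c) :=
  ⟨Polynomial.C c, 1, by simp, by simp, by simp⟩

lemma one : HasValue ζ (1 : RatFunc F) 1 := by simpa using C (ζ := ζ) (1 : F)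

lemma zero : HasValue ζ (0 : RatFunc F) 0 := by simpa using C (ζ := ζ) (0 : F)

lemma mul (hf : HasValue ζ f v) (hg : HasValue ζ g w) : HasValue ζ (f * g) (v * w) := by
  obtain ⟨P, S, h1, h2, h3⟩ := hf
  obtain ⟨Q, T, k1, k2, k3⟩ := hg
  refine ⟨P * Q, S * T, by simp [h1, k1], ?_, ?_⟩
  · rw [map_mul, map_mul, ← h2, ← k2]; ring
  · rw [map_mul, map_mul, ← h3, ← k3]; ring

lemma add (hf : HasValue ζ f v) (hg : HasValue ζ g w) : HasValue ζ (f + g) (v + w) := by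
  obtain ⟨P, S, h1, h2, h3⟩ := hf
  obtain ⟨Q, T, k1, k2, k3⟩ := hg
  refine ⟨P * T + Q * S, S * T, by simp [h1, k1], ?_, ?_⟩
  · rw [map_mul, map_add, map_mul, map_mul, ← h2, ← k2]; ring
  · rw [map_mul, map_add, map_mul, map_mul, ← h3, ← k3]; ring

lemma neg (hf : HasValue ζ f v) : HasValue ζ (-f) (-v) := by
  simpa using (C (ζ := ζ) (-1 : F)).mul hf

lemma sub (hf : HasValue ζ f v) (hg : HasValue ζ g w) : HasValue ζ (f - g) (v - w) := by
  simpa [sub_eq_add_neg] using hf.add hg.neg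

lemma num_eq_zero (hf : HasValue ζ f 0) : aeval ζ f.num = 0 := by
  obtain ⟨P, S, h1, h2, h3⟩ := hf
  have h : algebraMap F[X] (RatFunc F) (f.num * S) =
      algebraMap F[X] (RatFunc F) (P * f.denom) := by
    have hd : algebraMap F[X] (RatFunc F) f.denom ≠ 0 :=
      RatFunc.algebraMap_ne_zero f.denom_ne_zero
    rw [map_mul, map_mul, ← h2, mul_right_comm, mul_comm f]
    rw [(div_eq_iff hd).1 (RatFunc.num_div_denom f)]
    ring
  have h' := congrArg (aeval ζ) (RatFunc.algebraMap_injective F h)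
  rw [map_mul, map_mul, ← h3] at h'
  simpa [h1] using h'

lemma ne_zero (hf : HasValue ζ f v) (hv : v ≠ 0) : f ≠ 0 := by
  rintro rfl
  obtain ⟨P, S, h1, h2, h3⟩ := hf
  rw [zero_mul, eq_comm, map_eq_zero_iff _ (RatFunc.algebraMap_injective F)] at h2
  simp [h2, hv, h1] at h3

lemma unique (hf : HasValue ζ f v) (hg : HasValue ζ f w) : v = w := by
  by_contra h
  exact (hf.sub hg).ne_zero (sub_ne_zero.2 h) (sub_self f)

lemma inv (hf : HasValue ζ f v) (hv : v ≠ 0) : HasValue ζ f⁻¹ v⁻¹ := by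
  have hf0 := hf.ne_zero hv
  obtain ⟨P, S, h1, h2, h3⟩ := hf
  refine ⟨S, P, ?_, ?_, ?_⟩
  · rw [← h3]; exact mul_ne_zero hv h1
  · rw [← h2, inv_mul_cancel_left₀ hf0]
  · rw [← h3, inv_mul_cancel_left₀ hv]

lemma div (hf : HasValue ζ f v) (hg : HasValue ζ g w) (hw : w ≠ 0) :
    HasValue ζ (f / g) (v / w) := by
  simpa [div_eq_mul_inv] using hf.mul (hg.inv hw)

lemma pow (hf : HasValue ζ f v) (k : ℕ) : HasValue ζ (f ^ k) (v ^ k) := by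
  induction k with
  | zero => simpa using one
  | succ k ih => simpa [pow_succ] using ih.mul hf

lemma sum {f : ℕ → RatFunc F} {v : ℕ → L} {s : Finset ℕ} (h : ∀ i ∈ s, HasValue ζ (f i) (v i)) :
    HasValue ζ (∑ i ∈ s, f i) (∑ i ∈ s, v i) := by
  induction s using Finset.cons_induction with
  | empty => simpa using zero
  | cons a s ha ih =>
    rw [Finset.sum_cons, Finset.sum_cons]
    exact (h a (by simp)).add (ih fun i hi => h i (by simp [hi]))

lemma prod {f : ℕ → RatFunc F} {v : ℕ → L} {s : Finset ℕ} (h : ∀ i ∈ s, HasValue ζ (f i) (v i)) :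
    HasValue ζ (∏ i ∈ s, f i) (∏ i ∈ s, v i) := by
  induction s using Finset.cons_induction with
  | empty => simpa using one
  | cons a s ha ih =>
    rw [Finset.prod_cons, Finset.prod_cons]
    exact (h a (by simp)).mul (ih fun i hi => h i (by simp [hi]))

lemma one_sub (hf : HasValue ζ f v) : HasValue ζ (1 - f) (1 - v) := one.sub hf

lemma qPoch (hf : HasValue ζ f v) (hg : HasValue ζ g w) (k : ℕ) :
    HasValue ζ (_root_.qPoch f g k) (_root_.qPoch v w k) :=
  prod fun i _ => (hf.mul (hg.pow i)).one_sub

lemma qint (hf : HasValue ζ f v) (k : ℕ) : HasValue ζ (_root_.qint f k) (_root_.qint v k) :=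
  sum fun i _ => hf.pow i

end HasValue

end Value

section Factors

variable {K : Type*} [Field K]

/-- The ratio of consecutive terms of the sum, apart from the factor `[6k+1]`. -/
def termRatio (q a b : K) (i : ℕ) : K :=
  ((1 - a * q * (q ^ 2) ^ i) * (1 - q / a * (q ^ 2) ^ i)) *
    ((1 - q ^ 2 * (q ^ 4) ^ i) * (1 - b * q * (q ^ 4) ^ i) * (1 - q / b * (q ^ 4) ^ i)) /
    (((1 - q ^ 4 * (q ^ 4) ^ i) * (1 - q ^ 4 / a * (q ^ 4) ^ i) * (1 - a * q ^ 4 * (q ^ 4) ^ i)) *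
      ((1 - q ^ 2 / b * (q ^ 2) ^ i) * (1 - b * q ^ 2 * (q ^ 2) ^ i))) * q ^ 2

/-- The `k`-th term of the sum. -/
def qTerm (q a b : K) (k : ℕ) : K :=
  qint q (6 * k + 1) * (qPoch (a * q) (q ^ 2) k * qPoch (q / a) (q ^ 2) k) *
    (qPoch (q ^ 2) (q ^ 4) k * qPoch (b * q) (q ^ 4) k * qPoch (q / b) (q ^ 4) k) /
    ((qPoch (q ^ 4) (q ^ 4) k * qPoch (q ^ 4 / a) (q ^ 4) k * qPoch (a * q ^ 4) (q ^ 4) k) *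
      (qPoch (q ^ 2 / b) (q ^ 2) k * qPoch (b * q ^ 2) (q ^ 2) k)) * q ^ (2 * k)

lemma qTerm_eq_prod (q a b : K) (k : ℕ) :
    qTerm q a b k = qint q (6 * k + 1) * ∏ i ∈ Finset.range k, termRatio q a b i := by
  simp only [qTerm, termRatio, qPoch, Finset.prod_mul_distrib, Finset.prod_div_distrib,
    Finset.prod_const, Finset.card_range, ← pow_mul]
  ring

lemma qint_mul (q : K) (r : ℕ) : qint q r * (1 - q) = 1 - q ^ r := by
  rw [qint, geom_sum_mul_neg]

end Factors

section RootOfUnity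

variable {L : Type*} [Field L] {ζ α β : L} {m : ℕ}

lemma one_sub_ne_zero_of_pow_ne_one {x : L} {d : ℕ} (h : x ^ d ≠ 1) : 1 - x ≠ 0 := by
  intro hx
  exact h (by rw [← sub_eq_zero.1 hx, one_pow])

lemma one_sub_pow_ne_zero (hζ : orderOf ζ = 2 * m + 1) {k : ℕ} (hk : ¬ 2 * m + 1 ∣ k) :
    1 - ζ ^ k ≠ 0 := fun h =>
  hk (hζ ▸ orderOf_dvd_of_pow_eq_one (sub_eq_zero.1 h).symm)

lemma odd_not_dvd_two_pow_mul {e k : ℕ} (hk : ¬ 2 * m + 1 ∣ k) : ¬ 2 * m + 1 ∣ 2 ^ e * k :=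
  fun h => hk (((by simp : Nat.Coprime (2 * m + 1) 2).pow_right e).dvd_of_dvd_mul_left h)

lemma one_sub_mul_pow_ne_zero (hζ : orderOf ζ = 2 * m + 1) (hα : α ^ (2 * m + 1) ≠ 1) (k : ℕ) :
    1 - α * ζ ^ k ≠ 0 := by
  refine one_sub_ne_zero_of_pow_ne_one (d := 2 * m + 1) ?_
  rwa [mul_pow, ← pow_mul, mul_comm k, pow_mul, ← hζ, pow_orderOf_eq_one, one_pow, mul_one, hζ]

lemma one_sub_pow_div_ne_zero (hζ : orderOf ζ = 2 * m + 1) (hα : α ^ (2 * m + 1) ≠ 1) (k : ℕ) :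
    1 - ζ ^ k / α ≠ 0 := by
  rw [div_eq_inv_mul]
  exact one_sub_mul_pow_ne_zero hζ (by rwa [inv_pow, ne_eq, inv_eq_one]) k

lemma one_sub_div_pow_ne_zero (hζ : orderOf ζ = 2 * m + 1) (hα : α ^ (2 * m + 1) ≠ 1) (k : ℕ) :
    1 - α / ζ ^ k ≠ 0 := by
  have h := one_sub_pow_div_ne_zero hζ hα k
  contrapose! h
  rw [← inv_div, ← sub_eq_zero.1 h, inv_one, sub_self]

lemma termRatio_add_mul (hζ : orderOf ζ = 2 * m + 1) (l i : ℕ) :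
    termRatio ζ α β (l * (2 * m + 1) + i) = termRatio ζ α β i := by
  have h : ∀ e : ℕ, (ζ ^ e) ^ (l * (2 * m + 1) + i) = (ζ ^ e) ^ i := fun e => by
    rw [pow_add, ← pow_mul, show e * (l * (2 * m + 1)) = orderOf ζ * (e * l) by rw [hζ]; ring,
      pow_mul, pow_orderOf_eq_one, one_pow, one_mul]
  simp only [termRatio, h]

lemma qTerm_eq_zero (hζ : orderOf ζ = 2 * m + 1) {k : ℕ} (hk : m < k) : qTerm ζ α β k = 0 := by
  have : qPoch (ζ ^ 2) (ζ ^ 4) k = 0 := by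
    refine Finset.prod_eq_zero (Finset.mem_range.2 hk) ?_
    rw [← pow_mul, ← pow_add, show 2 + 4 * m = orderOf ζ * 2 by rw [hζ]; ring, pow_mul,
      pow_orderOf_eq_one, one_pow, sub_self]
  simp [qTerm, this]

lemma qTerm_denom_ne_zero (hζ : orderOf ζ = 2 * m + 1) (hα : α ^ (2 * m + 1) ≠ 1)
    (hβ : β ^ (2 * m + 1) ≠ 1) {i : ℕ} (hi : ¬ 2 * m + 1 ∣ i + 1) :
    ((1 - ζ ^ 4 * (ζ ^ 4) ^ i) * (1 - ζ ^ 4 / α * (ζ ^ 4) ^ i) * (1 - α * ζ ^ 4 * (ζ ^ 4) ^ i)) *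
      ((1 - ζ ^ 2 / β * (ζ ^ 2) ^ i) * (1 - β * ζ ^ 2 * (ζ ^ 2) ^ i)) ≠ 0 := by
  have e4 : ζ ^ 4 * (ζ ^ 4) ^ i = ζ ^ (2 ^ 2 * (i + 1)) := by ring
  have e2 : ζ ^ 2 * (ζ ^ 2) ^ i = ζ ^ (2 * (i + 1)) := by ring
  rw [div_mul_eq_mul_div, div_mul_eq_mul_div, mul_assoc α, mul_assoc β, e4, e2]
  have h1 := one_sub_pow_ne_zero hζ (odd_not_dvd_two_pow_mul (e := 2) hi)
  have h2 := one_sub_pow_div_ne_zero hζ hα (2 ^ 2 * (i + 1))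
  have h3 := one_sub_mul_pow_ne_zero hζ hα (2 ^ 2 * (i + 1))
  have h4 := one_sub_pow_div_ne_zero hζ hβ (2 * (i + 1))
  have h5 := one_sub_mul_pow_ne_zero hζ hβ (2 * (i + 1))
  exact mul_ne_zero (mul_ne_zero (mul_ne_zero h1 h2) h3) (mul_ne_zero h4 h5)

lemma qPoch_sq_ne_zero (hζ : orderOf ζ = 2 * m + 1) {k : ℕ} (hk : k ≤ m) :
    qPoch ζ (ζ ^ 2) k ≠ 0 := qPoch_ne_zero fun i hi => by
  rw [show ζ * (ζ ^ 2) ^ i = ζ ^ (2 * i + 1) by ring]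
  exact one_sub_pow_ne_zero hζ (Nat.not_dvd_of_pos_of_lt (by omega) (by omega))

lemma quadTerm_denom_ne_zero (hζ : orderOf ζ = 2 * m + 1) (hα0 : α ≠ 0) (hβ0 : β ≠ 0)
    (hα : α ^ (2 * m + 1) ≠ 1) (hβ : β ^ (2 * m + 1) ≠ 1) {k : ℕ} (hk : k ≤ m) :
    (qPoch ((ζ ^ 2) ^ 2) ((ζ ^ 2) ^ 2) k * qPoch (ζ * (ζ ^ 2) ^ 2 / (α * ζ)) ((ζ ^ 2) ^ 2) k *
        qPoch (ζ * (α * ζ) * ζ ^ 2) ((ζ ^ 2) ^ 2) k) *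
      (qPoch (ζ / (β / ζ ^ 2 * ζ)) (ζ ^ 2) k * qPoch (β / ζ ^ 2 * (ζ ^ 2) ^ 2) (ζ ^ 2) k *
        qPoch ζ (ζ ^ 2) k) ≠ 0 := by
  have hζ0 : ζ ≠ 0 := by
    rintro rfl
    simp at hζ
  refine mul_ne_zero (mul_ne_zero (mul_ne_zero ?_ ?_) ?_)
    (mul_ne_zero (mul_ne_zero ?_ ?_) (qPoch_sq_ne_zero hζ hk))
  all_goals refine qPoch_ne_zero fun i hi => ?_
  · rw [show (ζ ^ 2) ^ 2 * ((ζ ^ 2) ^ 2) ^ i = ζ ^ (2 ^ 2 * (i + 1)) by ring]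
    exact one_sub_pow_ne_zero hζ
      (odd_not_dvd_two_pow_mul (Nat.not_dvd_of_pos_of_lt (by omega) (by omega)))
  · rw [show ζ * (ζ ^ 2) ^ 2 / (α * ζ) * ((ζ ^ 2) ^ 2) ^ i = ζ ^ (4 * i + 4) / α by
      field_simp; ring]
    exact one_sub_pow_div_ne_zero hζ hα _
  · rw [show ζ * (α * ζ) * ζ ^ 2 * ((ζ ^ 2) ^ 2) ^ i = α * ζ ^ (4 * i + 4) by ring]
    exact one_sub_mul_pow_ne_zero hζ hα _
  · rw [show ζ / (β / ζ ^ 2 * ζ) * (ζ ^ 2) ^ i = ζ ^ (2 * i + 2) / β by field_simp; ring]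
    exact one_sub_pow_div_ne_zero hζ hβ _
  · rw [show β / ζ ^ 2 * (ζ ^ 2) ^ 2 * (ζ ^ 2) ^ i = β * ζ ^ (2 * i + 2) by field_simp; ring]
    exact one_sub_mul_pow_ne_zero hζ hβ _

/-- At a root of unity of order `2 m + 1` the summand is a specialization of `quadTerm`. -/
lemma quadTerm_eq_qTerm (hζ : orderOf ζ = 2 * m + 1) (hζ0 : ζ ≠ 0) (hα : α ≠ 0) (hβ : β ≠ 0)
    {k : ℕ} (hk : k ≤ m) :
    quadTerm ζ (α * ζ) (ζ ^ 2) (β / ζ ^ 2) ζ k = (1 - ζ) * qTerm ζ α β k := by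
  have hq := qPoch_sq_ne_zero hζ hk
  rw [quadTerm, qTerm,
    show β / ζ ^ 2 * ζ * ζ ^ 2 = β * ζ by field_simp,
    show ζ / (β / ζ ^ 2 * ζ ^ 2) = ζ / β by field_simp,
    show ζ * ζ ^ 2 / ζ = ζ ^ 2 by field_simp,
    show β / ζ ^ 2 * (ζ ^ 2) ^ 2 = β * ζ ^ 2 by field_simp,
    show (ζ ^ 2) ^ 2 = ζ ^ 4 by ring,
    show ζ ^ 2 / (α * ζ) = ζ / α by field_simp,
    show ζ * ζ ^ 4 / (α * ζ) = ζ ^ 4 / α by field_simp,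
    show ζ * (α * ζ) * ζ ^ 2 = α * ζ ^ 4 by ring,
    show ζ / (β / ζ ^ 2 * ζ) = ζ ^ 2 / β by field_simp,
    show 1 - ζ * ((ζ ^ 2) ^ k) ^ 3 = qint ζ (6 * k + 1) * (1 - ζ) by rw [qint_mul]; ring]
  rw [show (ζ ^ 2) ^ k = ζ ^ (2 * k) by ring]
  generalize qPoch ζ (ζ ^ 2) k = y at *
  have hy := mul_inv_cancel₀ hq
  simp only [div_eq_mul_inv, mul_inv]
  linear_combination (qint ζ (6 * k + 1) * (1 - ζ) * ζ ^ (2 * k) *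
    (qPoch (α * ζ) (ζ ^ 2) k * qPoch (ζ * α⁻¹) (ζ ^ 2) k) *
    (qPoch (β * ζ) (ζ ^ 4) k * qPoch (ζ * β⁻¹) (ζ ^ 4) k * qPoch (ζ ^ 2) (ζ ^ 4) k) *
    ((qPoch (ζ ^ 4) (ζ ^ 4) k)⁻¹ * (qPoch (ζ ^ 4 * α⁻¹) (ζ ^ 4) k)⁻¹ *
      (qPoch (α * ζ ^ 4) (ζ ^ 4) k)⁻¹ * ((qPoch (ζ ^ 2 * β⁻¹) (ζ ^ 2) k)⁻¹ *
      (qPoch (β * ζ ^ 2) (ζ ^ 2) k)⁻¹))) * hy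

end RootOfUnity

section Specialization

variable {F L : Type*} [Field F] [Field L] [Algebra F L]

lemma ratFunc_one_sub_X_pow_ne_zero {j : ℕ} (hj : j ≠ 0) : 1 - (RatFunc.X : RatFunc F) ^ j ≠ 0 := by
  intro h
  rw [← RatFunc.algebraMap_X, ← map_pow, ← map_one (algebraMap (Polynomial F) (RatFunc F)),
    ← map_sub, map_eq_zero_iff _ (RatFunc.algebraMap_injective F), sub_eq_zero] at h
  have := congrArg Polynomial.natDegree h
  simp at this
  exact hj this.symm

lemma HasValue.quadTerm {ζ : L} {a b p u w : RatFunc F} {a' b' p' u' w' : L}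
    (ha : HasValue ζ a a') (hb : HasValue ζ b b') (hp : HasValue ζ p p') (hu : HasValue ζ u u')
    (hw : HasValue ζ w w') (hb0 : b' ≠ 0) (hp0 : p' ≠ 0) (hu0 : u' ≠ 0) (hw0 : w' ≠ 0) (k : ℕ)
    (hk : (_root_.qPoch (p' ^ 2) (p' ^ 2) k * _root_.qPoch (a' * p' ^ 2 / b') (p' ^ 2) k *
        _root_.qPoch (a' * b' * p') (p' ^ 2) k) *
      (_root_.qPoch (a' / (u' * w')) p' k * _root_.qPoch (u' * p' ^ 2) p' k *
        _root_.qPoch w' p' k) ≠ 0) :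
    HasValue ζ (_root_.quadTerm a b p u w k) (_root_.quadTerm a' b' p' u' w' k) := by
  have hp2 := hp.pow 2
  refine HasValue.div ?_ ?_ hk
  · exact ((((ha.mul ((hp.pow k).pow 3)).one_sub).mul (hp.pow k)).mul
      (((ha.qPoch hp k).mul (hb.qPoch hp k)).mul ((hp.div hb hb0).qPoch hp k))).mul
      (((((hu.mul hw).mul hp).qPoch hp2 k).mul
        ((ha.div (hu.mul hp) (mul_ne_zero hu0 hp0)).qPoch hp2 k)).mul
        (((ha.mul hp).div hw hw0).qPoch hp2 k))
  · exact (((hp2.qPoch hp2 k).mul (((ha.mul hp2).div hb hb0).qPoch hp2 k)).mul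
      (((ha.mul hb).mul hp).qPoch hp2 k)).mul
      ((((ha.div (hu.mul hw) (mul_ne_zero hu0 hw0)).qPoch hp k).mul
        ((hu.mul hp2).qPoch hp k)).mul (hw.qPoch hp k))

variable {ζ : L} {A B : F} {m : ℕ}

lemma hasValue_termRatio (hζ : orderOf ζ = 2 * m + 1) (hA : A ≠ 0) (hB : B ≠ 0)
    (hα : algebraMap F L A ^ (2 * m + 1) ≠ 1) (hβ : algebraMap F L B ^ (2 * m + 1) ≠ 1)
    {i : ℕ} (hi : ¬ 2 * m + 1 ∣ i + 1) :
    HasValue ζ (termRatio RatFunc.X (RatFunc.C A) (RatFunc.C B) i)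
      (termRatio ζ (algebraMap F L A) (algebraMap F L B) i) := by
  have hX := HasValue.X (F := F) (ζ := ζ)
  have ha := HasValue.C (ζ := ζ) A
  have hb := HasValue.C (ζ := ζ) B
  have hA' : algebraMap F L A ≠ 0 := by simpa
  have hB' : algebraMap F L B ≠ 0 := by simpa
  have h4 := (hX.pow 4).pow i
  have h2 := (hX.pow 2).pow i
  refine (HasValue.div ?_ ?_ (qTerm_denom_ne_zero hζ hα hβ hi)).mul (hX.pow 2)
  · exact ((((ha.mul hX).mul h2).one_sub).mul (((hX.div ha hA').mul h2).one_sub)).mul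
      (((((hX.pow 2).mul h4).one_sub).mul (((hb.mul hX).mul h4).one_sub)).mul
        (((hX.div hb hB').mul h4).one_sub))
  · exact (((((hX.pow 4).mul h4).one_sub).mul ((((hX.pow 4).div ha hA').mul h4).one_sub)).mul
      (((ha.mul (hX.pow 4)).mul h4).one_sub)).mul
      (((((hX.pow 2).div hb hB').mul h2).one_sub).mul (((hb.mul (hX.pow 2)).mul h2).one_sub))

/-- The vanishing of the sum at a root of unity of order `2 m + 1`. -/
lemma sum_qTerm_eq_zero (hm : m ≠ 0) (hζ : orderOf ζ = 2 * m + 1) (hA : A ≠ 0) (hB : B ≠ 0)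
    (hα : algebraMap F L A ^ (2 * m + 1) ≠ 1) (hβ : algebraMap F L B ^ (2 * m + 1) ≠ 1) :
    ∑ k ∈ Finset.range (m + 1), qTerm ζ (algebraMap F L A) (algebraMap F L B) k = 0 := by
  have hX := HasValue.X (F := F) (ζ := ζ)
  have ha := HasValue.C (ζ := ζ) A
  have hb := HasValue.C (ζ := ζ) B
  set α := algebraMap F L A
  set β := algebraMap F L B
  have hA' : α ≠ 0 := by simpa [α]
  have hB' : β ≠ 0 := by simpa [β]
  have hζ1 : ζ ≠ 1 := by
    rintro rfl
    rw [orderOf_one] at hζ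
    omega
  have hζp : ζ ^ (2 * m + 1) = 1 := hζ ▸ pow_orderOf_eq_one ζ
  have hζ0 : ζ ≠ 0 := by
    rintro rfl
    simp at hζp
  have hA1 : A ≠ 1 := by
    rintro rfl
    simp [α] at hα
  have hB1 : B ≠ 1 := by
    rintro rfl
    simp [β] at hβ
  have hX0 : (RatFunc.X : RatFunc F) ≠ 0 := RatFunc.X_ne_zero
  have hCA : RatFunc.C A ≠ 0 := by simpa
  have hCB : RatFunc.C B ≠ 0 := by simpa
  have gX := HasValue.X (F := F) (ζ := (1 : F))
  have ga := HasValue.C (ζ := (1 : F)) A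
  have gb := HasValue.C (ζ := (1 : F)) B
  have sum_eq := sum_quadTerm (a := RatFunc.X) (b := RatFunc.C A * RatFunc.X)
    (d := RatFunc.C B * RatFunc.X) (p := (RatFunc.X : RatFunc F) ^ 2) hX0 (mul_ne_zero hCA hX0)
    (mul_ne_zero hCB hX0) (pow_ne_zero 2 hX0)
    (fun k => by
      rw [← pow_succ', ← pow_mul, ← pow_mul]
      exact ratFunc_one_sub_X_pow_ne_zero (by positivity))
    (fun k => ((gX.mul (((gX.pow 2).mul ((gX.pow 2).pow k)).pow 2)).div (ga.mul gX)
      (by simpa)).one_sub.ne_zero (sub_ne_zero.2 (Ne.symm (by simpa using hA1))))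
    (fun k => (((gX.mul (ga.mul gX)).mul (gX.pow 2)).mul
      (((gX.pow 2).pow k).pow 2)).one_sub.ne_zero (sub_ne_zero.2 (Ne.symm (by simpa using hA1))))
    (fun k => (((gX.mul (gX.pow 2)).div (gb.mul gX) (by simpa)).mul
      ((gX.pow 2).pow k)).one_sub.ne_zero (sub_ne_zero.2 (Ne.symm (by simpa using hB1))))
    (fun i k => (((gb.mul gX).div (gX.mul ((gX.pow 2).pow (2 * i + 2))) (by simp)).mul
      ((gX.pow 2).pow k)).one_sub.ne_zero (sub_ne_zero.2 (Ne.symm (by simpa using hB1))))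
    (fun i k => by
      rw [← pow_mul, ← pow_mul, ← pow_succ', ← pow_add]
      exact ratFunc_one_sub_X_pow_ne_zero (by positivity))
    (fun k => ((ga.mul gX).mul (gX.mul ((gX.pow 2).pow k))).one_sub.ne_zero
      (sub_ne_zero.2 (Ne.symm (by simpa using hA1))))
    (fun k => ((gX.mul ((gX.pow 2).pow k)).div (ga.mul gX) (by simpa)).one_sub.ne_zero
      (sub_ne_zero.2 (Ne.symm (by simpa using hA1)))) m
  have hu : ∀ i : ℕ, HasValue ζ
      (RatFunc.C B * RatFunc.X / (RatFunc.X * (RatFunc.X ^ 2) ^ (2 * i + 2)))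
      (β * ζ / (ζ * (ζ ^ 2) ^ (2 * i + 2))) := fun i =>
    (hb.mul hX).div (hX.mul ((hX.pow 2).pow _)) (by positivity)
  have hw : ∀ j : ℕ, HasValue ζ ((RatFunc.X : RatFunc F) * (RatFunc.X ^ 2) ^ j)
      (ζ * (ζ ^ 2) ^ j) := fun j => hX.mul ((hX.pow 2).pow _)
  have hp := hX.pow 2
  have w_eq : ζ * (ζ ^ 2) ^ (2 * m + 1) = ζ := by
    rw [← pow_mul, mul_comm 2, pow_mul, hζp, one_pow, mul_one]
  have u_eq : β * ζ / (ζ * (ζ ^ 2) ^ (2 * m + 2)) = β / ζ ^ 2 := by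
    rw [pow_succ (ζ ^ 2), ← mul_assoc ζ, w_eq]
    field_simp
  have hleft := HasValue.sum (ζ := ζ) (s := Finset.range (m + 1)) fun k hk =>
    HasValue.quadTerm hX (ha.mul hX) hp (u_eq ▸ hu m) (w_eq ▸ hw (2 * m + 1))
      (mul_ne_zero hA' hζ0) (pow_ne_zero 2 hζ0) (div_ne_zero hB' (pow_ne_zero 2 hζ0)) hζ0 k
      (quadTerm_denom_ne_zero hζ hA' hB' hα hβ (Nat.lt_succ_iff.1 (Finset.mem_range.1 hk)))
  have hright := hX.one_sub.mul (HasValue.prod (ζ := ζ) (s := Finset.range m) fun i _ =>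
    HasValue.div (((hw (2 * i + 1)).one_sub.mul (hw (2 * i + 2)).one_sub).mul
      (((ha.mul hX).mul (hu i)).one_sub.mul
        (((hu i).mul hp).div (ha.mul hX) (mul_ne_zero hA' hζ0)).one_sub))
      (((hu i).one_sub.mul ((hu i).mul hp).one_sub).mul
        (((ha.mul hX).mul (hw (2 * i + 1))).one_sub.mul
          ((hw (2 * i + 2)).div (ha.mul hX) (mul_ne_zero hA' hζ0)).one_sub)) (by
      rw [show β * ζ / (ζ * (ζ ^ 2) ^ (2 * i + 2)) = β / ζ ^ (4 * i + 4) by field_simp; ring_nf,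
        show β / ζ ^ (4 * i + 4) * ζ ^ 2 = β / ζ ^ (4 * i + 2) by field_simp; ring,
        show α * ζ * (ζ * (ζ ^ 2) ^ (2 * i + 1)) = α * ζ ^ (4 * i + 4) by ring,
        show ζ * (ζ ^ 2) ^ (2 * i + 2) / (α * ζ) = ζ ^ (4 * i + 4) / α by field_simp; ring_nf]
      exact mul_ne_zero (mul_ne_zero (one_sub_div_pow_ne_zero hζ hβ _)
        (one_sub_div_pow_ne_zero hζ hβ _)) (mul_ne_zero (one_sub_mul_pow_ne_zero hζ hα _)
        (one_sub_pow_div_ne_zero hζ hα _))))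
  rw [← sum_eq] at hright
  have hval := hleft.unique hright
  rw [Finset.sum_congr rfl fun k hk => quadTerm_eq_qTerm hζ hζ0 hA' hB'
    (Nat.lt_succ_iff.1 (Finset.mem_range.1 hk)), ← Finset.mul_sum] at hval
  have hzero : ∃ i < m, (1 - ζ * (ζ ^ 2) ^ (2 * i + 1)) * (1 - ζ * (ζ ^ 2) ^ (2 * i + 2)) = 0 := by
    obtain ⟨s, rfl | rfl⟩ := m.even_or_odd'
    · obtain ⟨t, rfl⟩ := Nat.exists_eq_succ_of_ne_zero (show s ≠ 0 by omega)
      refine ⟨t, by omega, mul_eq_zero_of_right _ ?_⟩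
      rw [← pow_mul, ← pow_succ', sub_eq_zero, ← hζp]
      congr 1
    · refine ⟨s, by omega, mul_eq_zero_of_left ?_ _⟩
      rw [← pow_mul, ← pow_succ', sub_eq_zero, ← hζp]
  obtain ⟨i, hi, hi0⟩ := hzero
  rw [Finset.prod_eq_zero (Finset.mem_range.2 hi) (by rw [hi0]; simp), mul_zero] at hval
  exact (mul_eq_zero.1 hval).resolve_left (sub_ne_zero.2 hζ1.symm)

/-- The factor of `termRatio` that may have a pole at a root of unity is regular there after
multiplication over a whole period. -/
lemma exists_hasValue_prod_period [CharZero L] (hm : m ≠ 0) (hζ : orderOf ζ = 2 * m + 1) (l : ℕ) :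
    ∃ c : L, HasValue ζ (∏ i ∈ Finset.range (2 * m + 1),
      ((1 - (RatFunc.X : RatFunc F) ^ (4 * (l * (2 * m + 1) + i) + 2)) /
        (1 - RatFunc.X ^ (4 * (l * (2 * m + 1) + i) + 4)))) c := by
  have hX := HasValue.X (F := F) (ζ := ζ)
  have hden : ∀ i, ¬ 2 * m + 1 ∣ i + 1 → 1 - ζ ^ (4 * (l * (2 * m + 1) + i) + 4) ≠ 0 := by
    intro i hi
    rw [show 4 * (l * (2 * m + 1) + i) + 4 = 2 ^ 2 * (l * (2 * m + 1) + (i + 1)) by ring]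
    refine one_sub_pow_ne_zero hζ (odd_not_dvd_two_pow_mul ?_)
    rwa [Nat.dvd_add_right (dvd_mul_left _ _)]
  have hgeom : ∀ s, 1 - (RatFunc.X : RatFunc F) ^ ((2 * m + 1) * s) =
      qint (RatFunc.X ^ (2 * m + 1)) s * (1 - RatFunc.X ^ (2 * m + 1)) := fun s => by
    rw [qint_mul, pow_mul]
  have hqint : ∀ s, HasValue ζ (qint ((RatFunc.X : RatFunc F) ^ (2 * m + 1)) s) (s : L) := by
    intro s
    have := (hX.pow (2 * m + 1)).qint s
    rw [show ζ ^ (2 * m + 1) = 1 from hζ ▸ pow_orderOf_eq_one ζ] at this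
    simpa [qint] using this
  have hpole := (hqint (4 * l + 2)).div (hqint (4 * l + 4)) (Nat.cast_ne_zero.2 (by omega))
  rw [← mul_div_mul_right _ _ (ratFunc_one_sub_X_pow_ne_zero (F := F) (j := 2 * m + 1) (by omega)),
    ← hgeom, ← hgeom,
    show (2 * m + 1) * (4 * l + 2) = 4 * (l * (2 * m + 1) + m) + 2 by ring,
    show (2 * m + 1) * (4 * l + 4) = 4 * (l * (2 * m + 1) + 2 * m) + 4 by ring] at hpole
  have hcross := (hX.pow (4 * (l * (2 * m + 1) + 2 * m) + 2)).one_sub.div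
    (hX.pow (4 * (l * (2 * m + 1) + m) + 4)).one_sub
    (hden m (Nat.not_dvd_of_pos_of_lt (by omega) (by omega)))
  have hrest := HasValue.prod (ζ := ζ) (s := (Finset.range (2 * m)).erase m) fun i hi =>
    (hX.pow (4 * (l * (2 * m + 1) + i) + 2)).one_sub.div
      (hX.pow (4 * (l * (2 * m + 1) + i) + 4)).one_sub
      (hden i (Nat.not_dvd_of_pos_of_lt (by omega)
        (by have := Finset.mem_range.1 (Finset.mem_of_mem_erase hi); omega)))
  refine ⟨_, cast (congrArg (HasValue ζ · _) ?_) (hrest.mul (hpole.mul hcross))⟩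
  rw [Finset.prod_range_succ, ← Finset.mul_prod_erase (Finset.range (2 * m)) _
    (Finset.mem_range.2 (show m < 2 * m by omega))]
  simp only [div_eq_mul_inv]
  ring

/-- The product of the term ratios over whole periods is regular at `ζ`. -/
lemma exists_hasValue_prod_termRatio [CharZero L] (hm : m ≠ 0) (hζ : orderOf ζ = 2 * m + 1)
    (hA : A ≠ 0) (hB : B ≠ 0)
    (hα : algebraMap F L A ^ (2 * m + 1) ≠ 1) (hβ : algebraMap F L B ^ (2 * m + 1) ≠ 1) (l : ℕ) :
    ∃ c : L, HasValue ζ (∏ i ∈ Finset.range (l * (2 * m + 1)),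
      termRatio (RatFunc.X : RatFunc F) (RatFunc.C A) (RatFunc.C B) i) c := by
  have hX := HasValue.X (F := F) (ζ := ζ)
  have ha := HasValue.C (ζ := ζ) A
  have hb := HasValue.C (ζ := ζ) B
  have hA' : algebraMap F L A ≠ 0 := by simpa
  have hB' : algebraMap F L B ≠ 0 := by simpa
  have hreg : ∀ i, ∃ c : L, HasValue ζ
      (((1 - RatFunc.C A * RatFunc.X ^ (2 * i + 1)) * (1 - RatFunc.X ^ (2 * i + 1) / RatFunc.C A)) *
        ((1 - RatFunc.C B * RatFunc.X ^ (4 * i + 1)) *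
          (1 - RatFunc.X ^ (4 * i + 1) / RatFunc.C B)) /
        (((1 - RatFunc.X ^ (4 * i + 4) / RatFunc.C A) *
            (1 - RatFunc.C A * RatFunc.X ^ (4 * i + 4))) *
          ((1 - RatFunc.X ^ (2 * i + 2) / RatFunc.C B) *
            (1 - RatFunc.C B * RatFunc.X ^ (2 * i + 2)))) * RatFunc.X ^ 2) c := fun i =>
    ⟨_, ((((ha.mul (hX.pow _)).one_sub.mul ((hX.pow _).div ha hA').one_sub).mul
        ((hb.mul (hX.pow _)).one_sub.mul ((hX.pow _).div hb hB').one_sub)).div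
      ((((hX.pow _).div ha hA').one_sub.mul (ha.mul (hX.pow _)).one_sub).mul
        (((hX.pow _).div hb hB').one_sub.mul (hb.mul (hX.pow _)).one_sub))
      (mul_ne_zero
        (mul_ne_zero (one_sub_pow_div_ne_zero hζ hα _) (one_sub_mul_pow_ne_zero hζ hα _))
        (mul_ne_zero (one_sub_pow_div_ne_zero hζ hβ _) (one_sub_mul_pow_ne_zero hζ hβ _)))).mul
      (hX.pow 2)⟩
  choose c hc using hreg
  induction l with
  | zero => exact ⟨1, by simpa using HasValue.one⟩
  | succ l ih =>
    obtain ⟨c₁, h₁⟩ := ih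
    obtain ⟨c₂, h₂⟩ := exists_hasValue_prod_period (F := F) hm hζ l
    have h₃ := HasValue.prod (s := Finset.range (2 * m + 1)) fun i _ =>
      hc (l * (2 * m + 1) + i)
    refine ⟨_, cast (congrArg (HasValue ζ · _) ?_) (h₁.mul (h₂.mul h₃))⟩
    rw [add_one_mul l, Finset.prod_range_add _ (l * (2 * m + 1)), ← Finset.prod_mul_distrib]
    congr 1
    refine Finset.prod_congr rfl fun i _ => ?_
    generalize l * (2 * m + 1) + i = r
    have e1 : ∀ y : RatFunc F, y * (y ^ 2) ^ r = y ^ (2 * r + 1) := fun y => by ring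
    have e2 : ∀ y : RatFunc F, y * (y ^ 4) ^ r = y ^ (4 * r + 1) := fun y => by ring
    have e3 : ∀ y : RatFunc F, y ^ 4 * (y ^ 4) ^ r = y ^ (4 * r + 4) := fun y => by ring
    have e4 : ∀ y : RatFunc F, y ^ 2 * (y ^ 2) ^ r = y ^ (2 * r + 2) := fun y => by ring
    have e5 : ∀ y : RatFunc F, y ^ 2 * (y ^ 4) ^ r = y ^ (4 * r + 2) := fun y => by ring
    simp only [termRatio, div_mul_eq_mul_div, mul_assoc (RatFunc.C _), e1, e2, e3, e4, e5]
    simp only [div_eq_mul_inv, mul_inv]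
    ring

lemma hasValue_qTerm (hm : m ≠ 0) (hζ : orderOf ζ = 2 * m + 1) (hA : A ≠ 0) (hB : B ≠ 0)
    (hα : algebraMap F L A ^ (2 * m + 1) ≠ 1) (hβ : algebraMap F L B ^ (2 * m + 1) ≠ 1)
    {l : ℕ} {c : L} (hc : HasValue ζ (∏ i ∈ Finset.range (l * (2 * m + 1)),
      termRatio (RatFunc.X : RatFunc F) (RatFunc.C A) (RatFunc.C B) i) c)
    {j : ℕ} (hj : j < 2 * m + 1) :
    HasValue ζ (qTerm RatFunc.X (RatFunc.C A) (RatFunc.C B) (l * (2 * m + 1) + j))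
      (c * qTerm ζ (algebraMap F L A) (algebraMap F L B) j) := by
  have hprod := HasValue.prod (ζ := ζ) (s := Finset.range j) fun i hi =>
    hasValue_termRatio (L := L) (A := A) (B := B) (i := l * (2 * m + 1) + i) hζ hA hB hα hβ (by
      rw [add_assoc, Nat.dvd_add_right (dvd_mul_left _ _)]
      exact Nat.not_dvd_of_pos_of_lt (by omega) (by have := Finset.mem_range.1 hi; omega))
  simp only [termRatio_add_mul hζ] at hprod
  have hq := (HasValue.X (F := F) (ζ := ζ)).qint (6 * (l * (2 * m + 1) + j) + 1)
  have hq' : qint ζ (6 * (l * (2 * m + 1) + j) + 1) = qint ζ (6 * j + 1) := by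
    by_cases h1 : ζ = 1
    · rw [h1, orderOf_one] at hζ
      omega
    · refine mul_right_cancel₀ (sub_ne_zero.2 (Ne.symm h1)) ?_
      rw [qint_mul, qint_mul, show 6 * (l * (2 * m + 1) + j) + 1 =
        orderOf ζ * (6 * l) + (6 * j + 1) by rw [hζ]; ring, pow_add, pow_mul,
        pow_orderOf_eq_one, one_pow, one_mul]
  rw [hq'] at hq
  rw [qTerm_eq_prod, qTerm_eq_prod, Finset.prod_range_add, mul_left_comm c]
  exact hq.mul (hc.mul hprod)

/-- The sum up to the end of a whole period plus either nothing or a half period vanishes at `ζ`. -/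
lemma hasValue_sum_qTerm [CharZero L] (hm : m ≠ 0) (hζ : orderOf ζ = 2 * m + 1) (hA : A ≠ 0)
    (hB : B ≠ 0) (hα : algebraMap F L A ^ (2 * m + 1) ≠ 1)
    (hβ : algebraMap F L B ^ (2 * m + 1) ≠ 1) (l : ℕ) {r : ℕ} (hr : r = 0 ∨ r = m + 1) :
    HasValue ζ (∑ k ∈ Finset.range (l * (2 * m + 1) + r),
      qTerm (RatFunc.X : RatFunc F) (RatFunc.C A) (RatFunc.C B) k) 0 := by
  have hhalf := sum_qTerm_eq_zero hm hζ hA hB hα hβ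
  have hblock : ∀ l s, m + 1 ≤ s → s ≤ 2 * m + 1 → HasValue ζ (∑ j ∈ Finset.range s,
      qTerm (RatFunc.X : RatFunc F) (RatFunc.C A) (RatFunc.C B) (l * (2 * m + 1) + j)) 0 := by
    intro l s hs hs'
    obtain ⟨c, hc⟩ := exists_hasValue_prod_termRatio hm hζ hA hB hα hβ l
    have h := HasValue.sum (s := Finset.range s) fun j hj =>
      hasValue_qTerm hm hζ hA hB hα hβ hc ((Finset.mem_range.1 hj).trans_le hs')
    have htail : ∀ j ∈ Finset.range s, j ∉ Finset.range (m + 1) →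
        qTerm ζ (algebraMap F L A) (algebraMap F L B) j = 0 := fun j _ hj =>
      qTerm_eq_zero hζ (not_le.1 fun h => hj (Finset.mem_range.2 (Nat.lt_succ_of_le h)))
    rwa [← Finset.mul_sum, ← Finset.sum_subset (Finset.range_subset_range.2 hs) htail, hhalf,
      mul_zero] at h
  have hfull : ∀ l, HasValue ζ (∑ k ∈ Finset.range (l * (2 * m + 1)),
      qTerm (RatFunc.X : RatFunc F) (RatFunc.C A) (RatFunc.C B) k) 0 := by
    intro l
    induction l with
    | zero => simpa using HasValue.zero
    | succ l ih =>
      rw [add_one_mul l, Finset.sum_range_add]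
      simpa using ih.add (hblock l _ (by omega) le_rfl)
  obtain rfl | rfl := hr
  · exact hfull l
  · rw [Finset.sum_range_add]
    simpa using (hfull l).add (hblock l _ le_rfl (by omega))

end Specialization

section Divisibility

open Polynomial

variable {F : Type*} [Field F] [CharZero F]

/-- In characteristic zero `1 + X + ⋯ + X ^ (n - 1)` is separable, so divisibility by it can be
tested at its roots. -/
lemma geom_sum_X_dvd_of_forall_root {n : ℕ} (hn : n ≠ 0) {N : F[X]}
    (h : ∀ ζ : AlgebraicClosure F, ∑ i ∈ Finset.range n, ζ ^ i = 0 → aeval ζ N = 0) :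
    (∑ i ∈ Finset.range n, (X : F[X]) ^ i) ∣ N := by
  have hsep : (∑ i ∈ Finset.range n, (X : F[X]) ^ i).Separable := by
    refine Separable.of_dvd ((X_pow_sub_one_separable_iff (F := F)).2 (Nat.cast_ne_zero.2 hn)) ?_
    exact ⟨X - 1, (geom_sum_mul _ _).symm⟩
  rw [← map_dvd_map' (algebraMap F (AlgebraicClosure F))]
  rcases eq_or_ne N 0 with rfl | hN
  · simp
  refine (IsAlgClosed.splits _).dvd_of_roots_le_roots hsep.map.ne_zero ?_
  rw [Multiset.le_iff_subset (nodup_roots hsep.map)]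
  intro ζ hζ
  refine mem_aroots.2 ⟨hN, h ζ ?_⟩
  simpa [IsRoot, eval_finsetSum] using isRoot_of_mem_roots hζ

end Divisibility

lemma algebraMap_X_pow_ne_one {L : Type*} [Field L] [Algebra Qab L] (i : Fin 2) {d : ℕ}
    (hd : d ≠ 0) :
    algebraMap Qab L (algebraMap (MvPolynomial (Fin 2) ℚ) Qab (MvPolynomial.X i)) ^ d ≠ 1 := by
  intro h
  rw [← map_pow, ← map_pow, map_eq_one_iff _ (algebraMap Qab L).injective,
    map_eq_one_iff _ (IsFractionRing.injective (MvPolynomial (Fin 2) ℚ) Qab)] at h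
  simpa [hd] using congrArg (MvPolynomial.eval 0) h

/-- A nontrivial root of unity of odd order splits both ranges of summation into whole periods plus
either nothing or a half period. -/
lemma exists_orderOf_eq_of_geom_sum_eq_zero {L : Type*} [Field L] [CharZero L] {n M : ℕ} {ζ : L}
    (hodd : Odd n) (hM : M = (n - 1) / 2 ∨ M = n - 1)
    (hζ : ∑ i ∈ Finset.range n, ζ ^ i = 0) :
    ∃ m l r, m ≠ 0 ∧ orderOf ζ = 2 * m + 1 ∧ (r = 0 ∨ r = m + 1) ∧
      M + 1 = l * (2 * m + 1) + r := by
  have hn0 : n ≠ 0 := hodd.pos.ne'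
  have hpow : ζ ^ n = 1 := by
    rw [← sub_eq_zero, ← geom_sum_mul, hζ, zero_mul]
  have hone : ζ ≠ 1 := by
    rintro rfl
    simp [hn0] at hζ
  obtain ⟨e, he⟩ := orderOf_dvd_of_pow_eq_one hpow
  obtain ⟨hd, ⟨l, hl⟩⟩ := Nat.odd_mul.1 (he ▸ hodd)
  obtain ⟨m, hm⟩ := hd
  have hm0 : m ≠ 0 := by
    rintro rfl
    exact hone (orderOf_eq_one_iff.1 hm)
  rw [hm, hl] at he
  obtain rfl | rfl := hM
  · refine ⟨m, l, m + 1, hm0, hm, Or.inr rfl, ?_⟩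
    have : n = 2 * (l * (2 * m + 1) + m) + 1 := by rw [he]; ring
    omega
  · refine ⟨m, 2 * l + 1, 0, hm0, hm, Or.inl rfl, ?_⟩
    rw [Nat.sub_add_cancel hodd.pos, he]
    ring

theorem stmt_11 (n : ℕ) (hn : 1 < n) (hodd : Odd n) (M : ℕ)
    (hM : M = (n - 1) / 2 ∨ M = n - 1) :
    (∑ i ∈ Finset.range n, (Polynomial.X : Polynomial Qab) ^ i) ∣
      (∑ k ∈ Finset.range (M + 1),
          qint (RatFunc.X : RatFunc Qab) (6 * k + 1) *
            (qPoch (aa * RatFunc.X) (RatFunc.X ^ 2) k *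
              qPoch (RatFunc.X / aa) (RatFunc.X ^ 2) k) *
            (qPoch ((RatFunc.X : RatFunc Qab) ^ 2) (RatFunc.X ^ 4) k *
              qPoch (bb * RatFunc.X) (RatFunc.X ^ 4) k *
              qPoch (RatFunc.X / bb) (RatFunc.X ^ 4) k) /
            ((qPoch ((RatFunc.X : RatFunc Qab) ^ 4) (RatFunc.X ^ 4) k *
                qPoch ((RatFunc.X : RatFunc Qab) ^ 4 / aa) (RatFunc.X ^ 4) k *
                qPoch (aa * RatFunc.X ^ 4) (RatFunc.X ^ 4) k) *
              (qPoch ((RatFunc.X : RatFunc Qab) ^ 2 / bb) (RatFunc.X ^ 2) k *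
                qPoch (bb * RatFunc.X ^ 2) (RatFunc.X ^ 2) k)) *
            RatFunc.X ^ (2 * k)).num := by
  refine geom_sum_X_dvd_of_forall_root (by omega) fun ζ hζ => ?_
  obtain ⟨m, l, r, hm, hord, hr, hMr⟩ := exists_orderOf_eq_of_geom_sum_eq_zero hodd hM hζ
  have hX : ∀ i, algebraMap (MvPolynomial (Fin 2) ℚ) Qab (MvPolynomial.X i) ≠ 0 := fun i =>
    (map_ne_zero_iff _ (IsFractionRing.injective _ _)).2 (MvPolynomial.X_ne_zero i)
  rw [hMr]
  exact (hasValue_sum_qTerm hm hord (hX 0) (hX 1) (algebraMap_X_pow_ne_one 0 (by omega))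
    (algebraMap_X_pow_ne_one 1 (by omega)) l hr).num_eq_zero
end

section
/- Let p be an odd prime with p ≡ 3 (mod 4). Then Σ_{k=0}^{p-1} (6k+1)·(1/2)_k³·(1/4)_k² / k!⁵ ≡ (3p/4)·((1/2)_{(3p-1)/4})² / (((3p-1)/4)!)² modulo p⁵. -/
/-- The rising factorial (Pochhammer symbol) `(x)_k = x(x+1)⋯(x+k-1)`. -/
def risingFac (x : ℚ) (k : ℕ) : ℚ := ∏ i ∈ Finset.range k, (x + i)

theorem risingFac_succ (x : ℚ) (k : ℕ) : risingFac x (k + 1) = risingFac x k * (x + k) :=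
  Finset.prod_range_succ _ _

theorem risingFac_zero (x : ℚ) : risingFac x 0 = 1 := Finset.prod_range_zero _

theorem risingFac_add_one_mul (x : ℚ) (k : ℕ) :
    risingFac (x + 1) k * x = risingFac x k * (x + k) := by
  induction k with
  | zero => simp [risingFac_zero]
  | succ k ih =>
    rw [risingFac_succ, risingFac_succ]
    push_cast
    linear_combination (x + 1 + k) * ih

theorem risingFac_ne_zero {x : ℚ} (hx : ∀ j : ℕ, x + j ≠ 0) (k : ℕ) : risingFac x k ≠ 0 :=
  Finset.prod_ne_zero_iff.2 fun j _ => hx j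

theorem risingFac_neg_natCast_eq_zero {n k : ℕ} (h : n < k) : risingFac (-n) k = 0 :=
  Finset.prod_eq_zero (Finset.mem_range.2 h) (by ring)

theorem risingFac_one (k : ℕ) : risingFac 1 k = k.factorial := by
  induction k with
  | zero => simp [risingFac_zero]
  | succ k ih => rw [risingFac_succ, ih, Nat.factorial_succ]; push_cast; ring

/-- The product `∏_{j<k} ((x+j)² - D)`, that is `(x-δ)_k (x+δ)_k` when `D = δ²`. -/
def pairFac (x D : ℚ) (k : ℕ) : ℚ := ∏ j ∈ Finset.range k, ((x + j) ^ 2 - D)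

theorem pairFac_succ (x D : ℚ) (k : ℕ) :
    pairFac x D (k + 1) = pairFac x D k * ((x + k) ^ 2 - D) :=
  Finset.prod_range_succ _ _

theorem pairFac_zero (x D : ℚ) : pairFac x D 0 = 1 := Finset.prod_range_zero _

theorem pairFac_sq (x δ : ℚ) (k : ℕ) :
    pairFac x (δ ^ 2) k = risingFac (x - δ) k * risingFac (x + δ) k := by
  rw [pairFac, risingFac, risingFac, ← Finset.prod_mul_distrib]
  exact Finset.prod_congr rfl fun j _ => by ring

theorem pairFac_zero_right (x : ℚ) (k : ℕ) : pairFac x 0 k = risingFac x k ^ 2 := by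
  rw [pairFac, risingFac, ← Finset.prod_pow]
  simp

theorem pairFac_add_one_mul (x D : ℚ) (k : ℕ) :
    pairFac (x + 1) D k * (x ^ 2 - D) = pairFac x D k * ((x + k) ^ 2 - D) := by
  induction k with
  | zero => simp [pairFac_zero]
  | succ k ih =>
    rw [pairFac_succ, pairFac_succ]
    push_cast
    linear_combination ((x + 1 + k) ^ 2 - D) * ih

theorem pairFac_ne_zero {x D : ℚ} (hx : ∀ j : ℕ, (x + j) ^ 2 - D ≠ 0) (k : ℕ) :
    pairFac x D k ≠ 0 :=
  Finset.prod_ne_zero_iff.2 fun j _ => hx j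

/-- Creative telescoping for a hypergeometric term `h` with `h (k+1) / h k = X k / W (k+1)`
and certificate `z`. -/
theorem sum_range_of_certificate (h X W z P Q : ℕ → ℚ) (a b : ℚ)
    (hh : ∀ k, h (k + 1) * W (k + 1) = X k * h k) (hW : W 0 = 0)
    (hz : ∀ k, X k * z (k + 1) - W k * z k = a * P k - b * Q k) (K : ℕ) :
    a * ∑ k ∈ Finset.range K, P k * h k - b * ∑ k ∈ Finset.range K, Q k * h k =
      W K * z K * h K := by
  induction K with
  | zero => simp [hW]
  | succ K ih =>
    rw [Finset.sum_range_succ, Finset.sum_range_succ]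
    linear_combination ih + (-z (K + 1)) * hh K - h K * hz K

/-- The factor `(1/2-β)_k (1/2+β)_k / ((1-β/2)_k (1+β/2)_k)` with `B = β²`. -/
def uFac (B : ℚ) (k : ℕ) : ℚ := pairFac (1 / 2) B k / pairFac 1 (B / 4) k

/-- The factor `(1/4-δ/2)_k (1/4+δ/2)_k / ((1-δ)_k (1+δ)_k)` with `D = δ²`. -/
def vFac (D : ℚ) (k : ℕ) : ℚ := pairFac (1 / 4) (D / 4) k / pairFac 1 D k

/-- The factor `(6k+1) (1/2)_k / k!`. -/
def cFac (k : ℕ) : ℚ := (6 * k + 1) * (risingFac (1 / 2) k / k.factorial)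

theorem half_odd_ne_zero {x : ℚ} (m : ℤ) (hx : 2 * x = 2 * m + 1) : x ≠ 0 := by
  rintro rfl
  have : (2 * m + 1 : ℤ) = 0 := by exact_mod_cast (by linarith : (2 * m + 1 : ℚ) = 0)
  omega

theorem quarter_odd_ne_zero {x : ℚ} (m : ℤ) (hx : 4 * x = 2 * m + 1) : x ≠ 0 := by
  rintro rfl
  have : (2 * m + 1 : ℤ) = 0 := by exact_mod_cast (by linarith : (2 * m + 1 : ℚ) = 0)
  omega

theorem sq_sub_sq_ne_zero {x y : ℚ} (h1 : x - y ≠ 0) (h2 : x + y ≠ 0) : x ^ 2 - y ^ 2 ≠ 0 := by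
  rw [sq_sub_sq]
  exact mul_ne_zero h2 h1

theorem vFac_terminating (N k : ℕ) :
    vFac ((2 * N + 1 / 2) ^ 2) k =
      risingFac (-N) k * risingFac (N + 1 / 2) k /
        (risingFac (1 / 2 - 2 * N) k * risingFac (3 / 2 + 2 * N) k) := by
  rw [vFac, show ((2 * N + 1 / 2 : ℚ)) ^ 2 / 4 = (N + 1 / 4) ^ 2 by ring, pairFac_sq, pairFac_sq]
  ring_nf

set_option maxHeartbeats 2000000 in
theorem sum_uFac_vFac_succ (B : ℚ) (hB : ∀ j : ℕ, (1 + j : ℚ) ^ 2 - B / 4 ≠ 0) (N : ℕ) :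
    ((4 * N + 1) * ((1 + N) ^ 2 - B / 4)) *
        ∑ k ∈ Finset.range (N + 2), cFac k * uFac B k * vFac ((2 * (N + 1 : ℕ) + 1 / 2) ^ 2) k =
      ((4 * N + 5) * ((1 / 2 + N) ^ 2 - B / 4)) *
        ∑ k ∈ Finset.range (N + 1), cFac k * uFac B k * vFac ((2 * N + 1 / 2) ^ 2) k := by
  set h : ℕ → ℚ := fun k => risingFac (1 / 2) k * uFac B k * risingFac (-(N + 1 : ℕ)) k *
    risingFac (N + 1 / 2) k /
    (k.factorial * risingFac (1 / 2 - 2 * N) k * risingFac (7 / 2 + 2 * N) k) with hdef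
  set P0 : ℕ → ℚ := fun k => (6 * k + 1) * (N + 1 - k) * (3 / 2 + 2 * N + k) * (5 / 2 + 2 * N + k) /
    ((N + 1) * (3 / 2 + 2 * N) * (5 / 2 + 2 * N)) with hP0
  set P1 : ℕ → ℚ := fun k => (6 * k + 1) * (N + 1 / 2 + k) * (-3 / 2 - 2 * N + k) *
    (-1 / 2 - 2 * N + k) / ((N + 1 / 2) * (-3 / 2 - 2 * N) * (-1 / 2 - 2 * N)) with hP1
  have n0 : ∀ k, risingFac (1 / 2 - 2 * N) k ≠ 0 := risingFac_ne_zero fun j =>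
    half_odd_ne_zero (j - 2 * N) (by push_cast; ring)
  have n0' : ∀ k, risingFac (-3 / 2 - 2 * N) k ≠ 0 := risingFac_ne_zero fun j =>
    half_odd_ne_zero (j - 2 * N - 2) (by push_cast; ring)
  have n1 : ∀ k, risingFac (3 / 2 + 2 * N) k ≠ 0 := risingFac_ne_zero fun j => by positivity
  have n2 : ∀ k, risingFac (7 / 2 + 2 * N) k ≠ 0 := risingFac_ne_zero fun j => by positivity
  have e0 : (-3 / 2 - 2 * N : ℚ) ≠ 0 := half_odd_ne_zero (-2 * N - 2) (by push_cast; ring)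
  have e1 : (-1 / 2 - 2 * N : ℚ) ≠ 0 := half_odd_ne_zero (-2 * N - 1) (by push_cast; ring)
  have nf : ∀ k : ℕ, (k.factorial : ℚ) ≠ 0 := fun k => by positivity
  have nu : ∀ k, pairFac 1 (B / 4) k ≠ 0 := pairFac_ne_zero hB
  have t0 : ∀ k, cFac k * uFac B k * vFac ((2 * N + 1 / 2) ^ 2) k = P0 k * h k := by
    intro k
    have s1 := risingFac_add_one_mul (-(N + 1 : ℕ)) k
    have s2 := risingFac_add_one_mul (3 / 2 + 2 * N) k
    have s3 := risingFac_add_one_mul (3 / 2 + 2 * N + 1) k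
    rw [show (-((N + 1 : ℕ) : ℚ)) + 1 = -N by push_cast; ring] at s1
    rw [show (3 / 2 + 2 * N + 1 + 1 : ℚ) = 7 / 2 + 2 * N by ring] at s3
    have s1' : risingFac (-N) k = risingFac (-(N + 1 : ℕ)) k * (N + 1 - k) / (N + 1) := by
      rw [eq_div_iff (by positivity)]
      push_cast at s1 ⊢
      linear_combination -s1
    have s3' : risingFac (7 / 2 + 2 * N) k = risingFac (3 / 2 + 2 * N) k *
        ((3 / 2 + 2 * N + k) * (5 / 2 + 2 * N + k)) / ((3 / 2 + 2 * N) * (5 / 2 + 2 * N)) := by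
      rw [eq_div_iff (by positivity)]
      linear_combination (3 / 2 + 2 * N) * s3 + (5 / 2 + 2 * N + k) * s2
    rw [vFac_terminating, cFac, hP0, hdef]
    simp only
    rw [s1', s3']
    have := n0 k
    have := n1 k
    have := nf k
    field_simp
  have t1 : ∀ k, cFac k * uFac B k * vFac ((2 * (N + 1 : ℕ) + 1 / 2) ^ 2) k = P1 k * h k := by
    intro k
    have s1 := risingFac_add_one_mul (N + 1 / 2) k
    have s2 := risingFac_add_one_mul (-3 / 2 - 2 * N) k
    have s3 := risingFac_add_one_mul (-3 / 2 - 2 * N + 1) k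
    rw [show (-3 / 2 - 2 * N + 1 + 1 : ℚ) = 1 / 2 - 2 * N by ring] at s3
    have s1' : risingFac (N + 1 / 2 + 1) k = risingFac (N + 1 / 2) k * (N + 1 / 2 + k) /
        (N + 1 / 2) := by
      rw [eq_div_iff (by positivity)]
      exact s1
    have s3' : risingFac (1 / 2 - 2 * N) k = risingFac (-3 / 2 - 2 * N) k *
        ((-3 / 2 - 2 * N + k) * (-1 / 2 - 2 * N + k)) /
          ((-3 / 2 - 2 * N) * (-1 / 2 - 2 * N)) := by
      rw [eq_div_iff (mul_ne_zero e0 e1)]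
      linear_combination (-3 / 2 - 2 * N) * s3 + (-1 / 2 - 2 * N + k) * s2
    have h3 : (-3 / 2 - 2 * N + k : ℚ) ≠ 0 := half_odd_ne_zero (k - 2 * N - 2) (by push_cast; ring)
    have h1 : (-1 / 2 - 2 * N + k : ℚ) ≠ 0 := half_odd_ne_zero (k - 2 * N - 1) (by push_cast; ring)
    rw [vFac_terminating, cFac, hP1, hdef]
    simp only
    rw [show ((N + 1 : ℕ) : ℚ) + 1 / 2 = N + 1 / 2 + 1 by push_cast; ring,
      show (1 / 2 - 2 * (N + 1 : ℕ) : ℚ) = -3 / 2 - 2 * N by push_cast; ring,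
      show (3 / 2 + 2 * (N + 1 : ℕ) : ℚ) = 7 / 2 + 2 * N by push_cast; ring, s1', s3']
    have g0 := n0' k
    have g2 := n2 k
    have gf := nf k
    have e2 : (N + 1 / 2 : ℚ) ≠ 0 := by positivity
    clear_value h P0 P1
    clear * - g0 g2 gf e0 e1 e2 h1 h3
    generalize (-3 / 2 - 2 * N + k : ℚ) = w1 at *
    generalize (-1 / 2 - 2 * N + k : ℚ) = w2 at *
    generalize risingFac (-3 / 2 - 2 * N) k = r1 at *
    generalize risingFac (7 / 2 + 2 * N) k = r2 at *
    generalize (-3 / 2 - 2 * N : ℚ) = w3 at *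
    generalize (-1 / 2 - 2 * N : ℚ) = w4 at *
    generalize (N + 1 / 2 : ℚ) = w5 at *
    field_simp
  have key := sum_range_of_certificate h
    (fun k => (1 / 2 + k) * ((1 / 2 + k) ^ 2 - B) * (k - N - 1) * (k + N + 1 / 2))
    (fun k => k * ((k : ℚ) ^ 2 - B / 4) * (-1 / 2 - 2 * N + k) * (5 / 2 + 2 * N + k))
    (fun k => 2 / ((N + 1) * (N + 1 / 2)) * (2 * k - 1))
    P1 P0 ((4 * N + 1) * ((1 + N) ^ 2 - B / 4)) ((4 * N + 5) * ((1 / 2 + N) ^ 2 - B / 4))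
    ?_ (by simp) ?_ (N + 2)
  · have hz : h (N + 2) = 0 := by
      rw [hdef]
      simp only
      rw [risingFac_neg_natCast_eq_zero (by omega : N + 1 < N + 2)]
      simp
    have hl : P0 (N + 1) * h (N + 1) = 0 := by
      rw [hP0]
      simp
    rw [hz, mul_zero] at key
    rw [Finset.sum_congr rfl fun k _ => t1 k, Finset.sum_congr rfl fun k _ => t0 k]
    rw [Finset.sum_range_succ (fun k => P0 k * h k) (N + 1), hl, add_zero] at key
    exact sub_eq_zero.1 key
  · intro k
    rw [hdef]
    simp only
    have := n0 k
    have := n2 k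
    have := nf k
    have := nu k
    have := hB k
    have h1 : (1 / 2 - 2 * N + k : ℚ) ≠ 0 := half_odd_ne_zero (k - 2 * N) (by push_cast; ring)
    have h2 : (7 / 2 + 2 * N + k : ℚ) ≠ 0 := by positivity
    simp only [uFac, pairFac_succ, risingFac_succ, Nat.factorial_succ]
    rw [show ((k + 1 : ℕ) : ℚ) ^ 2 - B / 4 = (1 + k) ^ 2 - B / 4 by push_cast; ring,
      show (-1 / 2 - 2 * N + (k + 1 : ℕ) : ℚ) = 1 / 2 - 2 * N + k by push_cast; ring,
      show (5 / 2 + 2 * N + (k + 1 : ℕ) : ℚ) = 7 / 2 + 2 * N + k by push_cast; ring]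
    generalize (1 / 2 - 2 * N + k : ℚ) = w1 at *
    generalize (7 / 2 + 2 * N + k : ℚ) = w2 at *
    generalize ((1 + k : ℚ) ^ 2 - B / 4) = w3 at *
    push_cast
    field_simp
    ring
  · intro k
    rw [hP0, hP1]
    have e2 : (3 / 2 + 2 * N : ℚ) ≠ 0 := by positivity
    have e3 : (1 / 2 + 2 * N : ℚ) ≠ 0 := by positivity
    have e4 : (-3 / 2 - 2 * N : ℚ) = - (3 / 2 + 2 * N) := by ring
    have e5 : (-1 / 2 - 2 * N : ℚ) = - (1 / 2 + 2 * N) := by ring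
    simp only [e4, e5]
    push_cast
    field_simp
    ring

theorem sum_uFac_vFac_terminating (B : ℚ) (hB : ∀ j : ℕ, (1 + j : ℚ) ^ 2 - B / 4 ≠ 0) (N : ℕ) :
    ∑ k ∈ Finset.range (N + 1), cFac k * uFac B k * vFac ((2 * N + 1 / 2) ^ 2) k =
      (4 * N + 1) *
        ∏ j ∈ Finset.range N, ((1 / 2 + j) ^ 2 - B / 4) / ((1 + j) ^ 2 - B / 4) := by
  induction N with
  | zero => simp [cFac, uFac, vFac, pairFac_zero, risingFac_zero]
  | succ N ih =>
    have hs := sum_uFac_vFac_succ B hB N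
    have := hB N
    have h4 : (4 * N + 1 : ℚ) ≠ 0 := by positivity
    rw [ih] at hs
    rw [Finset.prod_range_succ]
    apply mul_left_cancel₀ (mul_ne_zero h4 this)
    rw [hs]
    generalize ((1 + N : ℚ) ^ 2 - B / 4) = w at *
    push_cast
    field_simp
    ring

theorem uFac_terminating (m k : ℕ) :
    uFac ((m + 1 / 2) ^ 2) k =
      risingFac (-m) k * risingFac (m + 1) k /
        (risingFac (3 / 4 - m / 2) k * risingFac (5 / 4 + m / 2) k) := by
  rw [uFac, show ((m + 1 / 2 : ℚ)) ^ 2 / 4 = (m / 2 + 1 / 4) ^ 2 by ring, pairFac_sq, pairFac_sq]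
  ring_nf

set_option maxHeartbeats 2000000 in
theorem sum_uFac_vFac_zero_add_two (m : ℕ) :
    ((m + 1 / 2) * (m + 2) ^ 2) *
        ∑ k ∈ Finset.range (m + 3), cFac k * uFac (((m + 2 : ℕ) + 1 / 2) ^ 2) k * vFac 0 k =
      ((m + 5 / 2) * (m + 1) ^ 2) *
        ∑ k ∈ Finset.range (m + 1), cFac k * uFac ((m + 1 / 2) ^ 2) k * vFac 0 k := by
  set h : ℕ → ℚ := fun k => risingFac (1 / 2) k * vFac 0 k * risingFac (-(m + 2 : ℕ)) k *
    risingFac (m + 1) k /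
    (k.factorial * risingFac (3 / 4 - m / 2) k * risingFac (9 / 4 + m / 2) k) with hdef
  set P0 : ℕ → ℚ := fun k => (6 * k + 1) * ((m + 2 - k) * (m + 1 - k)) * (5 / 4 + m / 2 + k) /
    (((m + 1) * (m + 2)) * (5 / 4 + m / 2)) with hP0
  set P1 : ℕ → ℚ := fun k => (6 * k + 1) * ((m + 1 + k) * (m + 2 + k)) * (-1 / 4 - m / 2 + k) /
    (((m + 1) * (m + 2)) * (-1 / 4 - m / 2)) with hP1
  have n0 : ∀ k, risingFac (3 / 4 - m / 2) k ≠ 0 := risingFac_ne_zero fun j =>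
    quarter_odd_ne_zero (2 * j - m + 1) (by push_cast; ring)
  have n0' : ∀ k, risingFac (-1 / 4 - m / 2) k ≠ 0 := risingFac_ne_zero fun j =>
    quarter_odd_ne_zero (2 * j - m - 1) (by push_cast; ring)
  have n1 : ∀ k, risingFac (5 / 4 + m / 2) k ≠ 0 := risingFac_ne_zero fun j => by positivity
  have n2 : ∀ k, risingFac (9 / 4 + m / 2) k ≠ 0 := risingFac_ne_zero fun j => by positivity
  have e0 : (-1 / 4 - m / 2 : ℚ) ≠ 0 := quarter_odd_ne_zero (-m - 1) (by push_cast; ring)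
  have nf : ∀ k : ℕ, (k.factorial : ℚ) ≠ 0 := fun k => by positivity
  have nu : ∀ k, pairFac 1 0 k ≠ 0 := pairFac_ne_zero fun j => by rw [sub_zero]; positivity
  have t0 : ∀ k, cFac k * uFac ((m + 1 / 2) ^ 2) k * vFac 0 k = P0 k * h k := by
    intro k
    have s1 := risingFac_add_one_mul (-(m + 2 : ℕ)) k
    have s2 := risingFac_add_one_mul (-(m + 1 : ℕ)) k
    have s3 := risingFac_add_one_mul (5 / 4 + m / 2) k
    rw [show (-((m + 2 : ℕ) : ℚ)) + 1 = -(m + 1 : ℕ) by push_cast; ring] at s1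
    rw [show (-((m + 1 : ℕ) : ℚ)) + 1 = -m by push_cast; ring] at s2
    rw [show (5 / 4 + m / 2 + 1 : ℚ) = 9 / 4 + m / 2 by ring] at s3
    have s1' : risingFac (-m) k = risingFac (-(m + 2 : ℕ)) k * ((m + 2 - k) * (m + 1 - k)) /
        ((m + 1) * (m + 2)) := by
      rw [eq_div_iff (by positivity)]
      push_cast at s1 s2 ⊢
      linear_combination (-(m + 1 - k) : ℚ) * s1 - (m + 2) * s2
    have s3' : risingFac (9 / 4 + m / 2) k = risingFac (5 / 4 + m / 2) k *
        (5 / 4 + m / 2 + k) / (5 / 4 + m / 2) := by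
      rw [eq_div_iff (by positivity)]
      exact s3
    rw [uFac_terminating, cFac, hP0, hdef]
    simp only
    rw [s1', s3']
    have := n0 k
    have := n1 k
    have := nf k
    field_simp
  have t1 : ∀ k, cFac k * uFac (((m + 2 : ℕ) + 1 / 2) ^ 2) k * vFac 0 k = P1 k * h k := by
    intro k
    have s1 := risingFac_add_one_mul (m + 1) k
    have s2 := risingFac_add_one_mul (m + 1 + 1) k
    have s3 := risingFac_add_one_mul (-1 / 4 - m / 2) k
    rw [show (-1 / 4 - m / 2 + 1 : ℚ) = 3 / 4 - m / 2 by ring] at s3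
    have s1' : risingFac (m + 1 + 1 + 1) k = risingFac (m + 1) k * ((m + 1 + k) * (m + 2 + k)) /
        ((m + 1) * (m + 2)) := by
      rw [eq_div_iff (by positivity)]
      linear_combination (m + 1 : ℚ) * s2 + (m + 2 + k) * s1
    have s3' : risingFac (3 / 4 - m / 2) k = risingFac (-1 / 4 - m / 2) k *
        (-1 / 4 - m / 2 + k) / (-1 / 4 - m / 2) := by
      rw [eq_div_iff e0]
      exact s3
    have h3 : (-1 / 4 - m / 2 + k : ℚ) ≠ 0 :=
      quarter_odd_ne_zero (2 * k - m - 1) (by push_cast; ring)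
    rw [uFac_terminating, cFac, hP1, hdef]
    simp only
    rw [show ((m + 2 : ℕ) : ℚ) + 1 = m + 1 + 1 + 1 by push_cast; ring,
      show (3 / 4 - (m + 2 : ℕ) / 2 : ℚ) = -1 / 4 - m / 2 by push_cast; ring,
      show (5 / 4 + (m + 2 : ℕ) / 2 : ℚ) = 9 / 4 + m / 2 by push_cast; ring, s1', s3']
    have g0 := n0' k
    have g2 := n2 k
    have gf := nf k
    clear_value h P0 P1
    clear * - g0 g2 gf e0 h3
    generalize (-1 / 4 - m / 2 + k : ℚ) = w1 at *
    generalize risingFac (-1 / 4 - m / 2) k = r1 at *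
    generalize risingFac (9 / 4 + m / 2) k = r2 at *
    generalize (-1 / 4 - m / 2 : ℚ) = w3 at *
    field_simp
  have key := sum_range_of_certificate h
    (fun k => (1 / 2 + k) * (k - m - 2) * (m + 1 + k) * (1 / 4 + k) ^ 2)
    (fun k => k ^ 3 * (-1 / 4 - m / 2 + k) * (5 / 4 + m / 2 + k))
    (fun k => 16 / ((m + 1) * (m + 2)) * (2 * k - 1))
    P1 P0 ((m + 1 / 2) * (m + 2) ^ 2) ((m + 5 / 2) * (m + 1) ^ 2)
    ?_ (by simp) ?_ (m + 3)
  · have hz : h (m + 3) = 0 := by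
      rw [hdef]
      simp only
      rw [risingFac_neg_natCast_eq_zero (by omega : m + 2 < m + 3)]
      simp
    have hl : P0 (m + 1) * h (m + 1) = 0 := by
      rw [hP0]
      simp
    have hl' : P0 (m + 2) * h (m + 2) = 0 := by
      rw [hP0]
      simp
    rw [hz, mul_zero] at key
    rw [Finset.sum_congr rfl fun k _ => t1 k, Finset.sum_congr rfl fun k _ => t0 k]
    rw [Finset.sum_range_succ (fun k => P0 k * h k) (m + 2), hl', add_zero,
      Finset.sum_range_succ (fun k => P0 k * h k) (m + 1), hl, add_zero] at key
    exact sub_eq_zero.1 key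
  · intro k
    rw [hdef]
    simp only
    have g0 := n0 k
    have g2 := n2 k
    have gf := nf k
    have gu := nu k
    have h1 : (3 / 4 - m / 2 + k : ℚ) ≠ 0 :=
      quarter_odd_ne_zero (2 * k - m + 1) (by push_cast; ring)
    have h2 : (9 / 4 + m / 2 + k : ℚ) ≠ 0 := by positivity
    simp only [vFac, pairFac_succ, risingFac_succ, Nat.factorial_succ]
    rw [show (-1 / 4 - m / 2 + (k + 1 : ℕ) : ℚ) = 3 / 4 - m / 2 + k by push_cast; ring,
      show (5 / 4 + m / 2 + (k + 1 : ℕ) : ℚ) = 9 / 4 + m / 2 + k by push_cast; ring]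
    clear_value h P0 P1
    clear * - g0 g2 gf gu h1 h2
    generalize (3 / 4 - m / 2 + k : ℚ) = w1 at *
    generalize (9 / 4 + m / 2 + k : ℚ) = w2 at *
    generalize risingFac (3 / 4 - m / 2) k = r1 at *
    generalize risingFac (9 / 4 + m / 2) k = r2 at *
    rw [zero_div, sub_zero, sub_zero]
    push_cast
    field_simp
    ring
  · intro k
    rw [hP0, hP1]
    have e2 : (5 / 4 + m / 2 : ℚ) ≠ 0 := by positivity
    have e3 : (1 / 4 + m / 2 : ℚ) ≠ 0 := by positivity
    have e4 : (-1 / 4 - m / 2 : ℚ) = - (1 / 4 + m / 2) := by ring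
    simp only [e4]
    push_cast
    field_simp
    ring

theorem sum_uFac_vFac_zero_of_odd (q : ℕ) :
    ∑ k ∈ Finset.range (2 * q + 2), cFac k * uFac (((2 * q + 1 : ℕ) + 1 / 2) ^ 2) k * vFac 0 k =
      0 := by
  induction q with
  | zero =>
    norm_num [Finset.sum_range_succ, cFac, uFac, vFac, pairFac_zero, risingFac_zero, pairFac_succ,
      risingFac_succ]
  | succ q ih =>
    have hs := sum_uFac_vFac_zero_add_two (2 * q + 1)
    rw [ih, mul_zero] at hs
    refine (mul_eq_zero.1 hs).resolve_left (ne_of_gt ?_)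
    positivity

/-- A summand whose numerator parameter `-n` makes the quadratic summation vanish. -/
def nullTerm (n : ℕ) (b D : ℚ) (k : ℕ) : ℚ :=
  (3 * k - n) * risingFac (-n) k ^ 2 * (risingFac b k * risingFac (1 - b) k) *
    pairFac (1 / 4) (D / 4) k /
    (k.factorial * risingFac (n + 1) k *
      (risingFac (1 - (n + b) / 2) k * risingFac ((1 + b - n) / 2) k) * pairFac (1 / 2 - n) D k)

set_option maxHeartbeats 4000000 in
theorem sum_nullTerm_succ (n : ℕ) (i e : ℤ) {b D : ℚ} (hb : b = i + 1 / 2) (hD : D = e ^ 2) :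
    (-(n + 1) * (n + 1 + b) * (n + b) * b * ((1 / 2 + n) ^ 2 - D)) *
        ∑ k ∈ Finset.range (n + 2), nullTerm (n + 1) (b + 1) D k =
      (b * (n + 1) ^ 3 * (D - (n + 1 / 2 + b) ^ 2)) *
        ∑ k ∈ Finset.range (n + 1), nullTerm n b D k := by
  set h : ℕ → ℚ := fun k => risingFac (-(n + 1 : ℕ)) k ^ 2 * (risingFac b k * risingFac (-b) k) *
    pairFac (1 / 4) (D / 4) k /
    (k.factorial * risingFac (n + 2) k *
      (risingFac (1 - (n + b) / 2) k * risingFac ((1 + b - n) / 2) k) * pairFac (1 / 2 - n) D k)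
    with hdef
  set P0 : ℕ → ℚ := fun k => (3 * k - n) * (n + 1 - k) ^ 2 * (n + 1 + k) * (b - k) /
    ((n + 1) ^ 3 * b) with hP0
  set P1 : ℕ → ℚ := fun k => (3 * k - n - 1) * (b + k) * (-(n + b) / 2 + k) *
    ((-1 / 2 - n + k) ^ 2 - D) / (b * (-(n + b) / 2) * ((-1 / 2 - n) ^ 2 - D)) with hP1
  have eb : b ≠ 0 := half_odd_ne_zero i (by rw [hb]; ring)
  have n0 : ∀ k, risingFac (1 - (n + b) / 2) k ≠ 0 := risingFac_ne_zero fun j =>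
    quarter_odd_ne_zero (2 * j + 1 - n - i) (by rw [hb]; push_cast; ring)
  have n0' : ∀ k, risingFac (-(n + b) / 2) k ≠ 0 := risingFac_ne_zero fun j =>
    quarter_odd_ne_zero (2 * j - 1 - n - i) (by rw [hb]; push_cast; ring)
  have n1 : ∀ k, risingFac ((1 + b - n) / 2) k ≠ 0 := risingFac_ne_zero fun j =>
    quarter_odd_ne_zero (2 * j + 1 - n + i) (by rw [hb]; push_cast; ring)
  have np : ∀ (x : ℚ) (m : ℤ), 2 * x = 2 * m + 1 → x ^ 2 - D ≠ 0 := fun x m hx => by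
    rw [hD]
    exact sq_sub_sq_ne_zero (half_odd_ne_zero (m - e) (by push_cast; linarith))
      (half_odd_ne_zero (m + e) (by push_cast; linarith))
  have n2 : ∀ k, pairFac (1 / 2 - n) D k ≠ 0 := pairFac_ne_zero fun j =>
    np _ (j - n) (by push_cast; ring)
  have n2' : ∀ k, pairFac (-1 / 2 - n) D k ≠ 0 := pairFac_ne_zero fun j =>
    np _ (j - n - 1) (by push_cast; ring)
  have n3 : ∀ k, risingFac (n + 1) k ≠ 0 := risingFac_ne_zero fun j => by positivity
  have n4 : ∀ k, risingFac (n + 2) k ≠ 0 := risingFac_ne_zero fun j => by positivity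
  have nf : ∀ k : ℕ, (k.factorial : ℚ) ≠ 0 := fun k => by positivity
  have ew : (-(n + b) / 2 : ℚ) ≠ 0 :=
    quarter_odd_ne_zero (-1 - n - i) (by rw [hb]; push_cast; ring)
  have ex : ((-1 / 2 - n) ^ 2 - D : ℚ) ≠ 0 := np _ (-n - 1) (by push_cast; ring)
  have t0 : ∀ k, nullTerm n b D k = P0 k * h k := by
    intro k
    have s1 := risingFac_add_one_mul (-(n + 1 : ℕ)) k
    have s2 := risingFac_add_one_mul (n + 1) k
    have s3 := risingFac_add_one_mul (-b) k
    rw [show (-((n + 1 : ℕ) : ℚ)) + 1 = -n by push_cast; ring] at s1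
    rw [show (n + 1 + 1 : ℚ) = n + 2 by ring] at s2
    rw [show -b + 1 = 1 - b by ring] at s3
    have s1' : risingFac (-n) k = risingFac (-(n + 1 : ℕ)) k * (n + 1 - k) / (n + 1) := by
      rw [eq_div_iff (by positivity)]
      push_cast at s1 ⊢
      linear_combination -s1
    have s2' : risingFac (n + 2) k = risingFac (n + 1) k * (n + 1 + k) / (n + 1) := by
      rw [eq_div_iff (by positivity)]
      exact s2
    have s3' : risingFac (1 - b) k = risingFac (-b) k * (b - k) / b := by
      rw [eq_div_iff eb]
      linear_combination -s3
    rw [nullTerm, hP0, hdef]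
    simp only
    rw [s1', s2', s3']
    have g0 := n0 k
    have g1 := n1 k
    have g2 := n2 k
    have g3 := n3 k
    have gf := nf k
    clear_value h P0 P1
    clear * - g0 g1 g2 g3 gf eb
    generalize risingFac (1 - (n + b) / 2) k = r1 at *
    generalize risingFac ((1 + b - n) / 2) k = r2 at *
    generalize pairFac (1 / 2 - n) D k = r3 at *
    field_simp
  have t1 : ∀ k, nullTerm (n + 1) (b + 1) D k = P1 k * h k := by
    intro k
    have s1 := risingFac_add_one_mul b k
    have s2 := risingFac_add_one_mul (-(n + b) / 2) k
    have s3 := pairFac_add_one_mul (-1 / 2 - n) D k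
    rw [show (-(n + b) / 2 + 1 : ℚ) = 1 - (n + b) / 2 by ring] at s2
    rw [show (-1 / 2 - n + 1 : ℚ) = 1 / 2 - n by ring] at s3
    rw [← eq_div_iff eb] at s1
    rw [← eq_div_iff ew] at s2
    rw [← eq_div_iff ex] at s3
    have h2 : (-(n + b) / 2 + k : ℚ) ≠ 0 :=
      quarter_odd_ne_zero (2 * k - 1 - n - i) (by rw [hb]; push_cast; ring)
    have h3 : ((-1 / 2 - n + k) ^ 2 - D : ℚ) ≠ 0 := np _ (k - n - 1) (by push_cast; ring)
    rw [nullTerm, hP1, hdef]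
    simp only
    rw [show ((n + 1 : ℕ) : ℚ) + 1 = n + 2 by push_cast; ring,
      show (1 - ((n + 1 : ℕ) + (b + 1)) / 2 : ℚ) = -(n + b) / 2 by push_cast; ring,
      show ((1 + (b + 1) - (n + 1 : ℕ)) / 2 : ℚ) = (1 + b - n) / 2 by push_cast; ring,
      show (1 / 2 - (n + 1 : ℕ) : ℚ) = -1 / 2 - n by push_cast; ring,
      show 1 - (b + 1) = -b by ring,
      show (3 * k - (n + 1 : ℕ) : ℚ) = 3 * k - n - 1 by push_cast; ring, s1, s2, s3]
    have g0 := n0' k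
    have g1 := n1 k
    have g2 := n2' k
    have g4 := n4 k
    have gf := nf k
    clear_value h P0 P1
    clear * - g0 g1 g2 g4 gf eb ew ex h2 h3
    generalize (-(n + b) / 2 + k : ℚ) = w1 at *
    generalize ((-1 / 2 - n + k) ^ 2 - D : ℚ) = w2 at *
    generalize risingFac (-(n + b) / 2) k = r1 at *
    generalize risingFac ((1 + b - n) / 2) k = r2 at *
    generalize pairFac (-1 / 2 - n) D k = r3 at *
    generalize (-(n + b) / 2 : ℚ) = w3 at *
    generalize ((-1 / 2 - n) ^ 2 - D : ℚ) = w4 at *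
    field_simp
  have key := sum_range_of_certificate h
    (fun k => (k - n - 1) ^ 2 * (b + k) * (k - b) * ((1 / 4 + k) ^ 2 - D / 4))
    (fun k => k * (n + 1 + k) * (-(n + b) / 2 + k) * ((b - n - 1) / 2 + k) *
      ((-1 / 2 - n + k) ^ 2 - D))
    (fun k => 4 * (k - 2 * (n + 1) - b))
    P1 P0 (-(n + 1) * (n + 1 + b) * (n + b) * b * ((1 / 2 + n) ^ 2 - D))
    (b * (n + 1) ^ 3 * (D - (n + 1 / 2 + b) ^ 2))
    ?_ (by simp) ?_ (n + 2)
  · have hz : h (n + 2) = 0 := by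
      rw [hdef]
      simp only
      rw [risingFac_neg_natCast_eq_zero (by omega : n + 1 < n + 2)]
      simp
    have hl : P0 (n + 1) * h (n + 1) = 0 := by
      rw [hP0]
      simp
    rw [hz, mul_zero] at key
    rw [Finset.sum_congr rfl fun k _ => t1 k, Finset.sum_congr rfl fun k _ => t0 k]
    rw [Finset.sum_range_succ (fun k => P0 k * h k) (n + 1), hl, add_zero] at key
    exact sub_eq_zero.1 key
  · intro k
    rw [hdef]
    simp only
    have g0 := n0 k
    have g1 := n1 k
    have g2 := n2 k
    have g4 := n4 k
    have gf := nf k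
    have h1 : (1 - (n + b) / 2 + k : ℚ) ≠ 0 :=
      quarter_odd_ne_zero (2 * k + 1 - n - i) (by rw [hb]; push_cast; ring)
    have h2 : ((1 + b - n) / 2 + k : ℚ) ≠ 0 :=
      quarter_odd_ne_zero (2 * k + 1 - n + i) (by rw [hb]; push_cast; ring)
    have h3 : ((1 / 2 - n + k) ^ 2 - D : ℚ) ≠ 0 := np _ (k - n) (by push_cast; ring)
    simp only [pairFac_succ, risingFac_succ, Nat.factorial_succ]
    rw [show (-(n + b) / 2 + (k + 1 : ℕ) : ℚ) = 1 - (n + b) / 2 + k by push_cast; ring,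
      show ((b - n - 1) / 2 + (k + 1 : ℕ) : ℚ) = (1 + b - n) / 2 + k by push_cast; ring,
      show (-1 / 2 - n + (k + 1 : ℕ) : ℚ) = 1 / 2 - n + k by push_cast; ring]
    clear_value h P0 P1
    clear * - g0 g1 g2 g4 gf h1 h2 h3
    generalize (1 - (n + b) / 2 + k : ℚ) = w1 at *
    generalize ((1 + b - n) / 2 + k : ℚ) = w2 at *
    generalize ((1 / 2 - n + k) ^ 2 - D : ℚ) = w3 at *
    generalize ((1 / 4 + k) ^ 2 - D / 4 : ℚ) = w4 at *
    generalize risingFac (1 - (n + b) / 2) k = r1 at *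
    generalize risingFac ((1 + b - n) / 2) k = r2 at *
    generalize pairFac (1 / 2 - n) D k = r3 at *
    generalize pairFac (1 / 4) (D / 4) k = r4 at *
    push_cast
    field_simp
    ring
  · intro k
    rw [hP0, hP1]
    have e1 : (n + b : ℚ) ≠ 0 := fun h0 => ew (by rw [h0]; simp)
    have e2 : ((1 / 2 + n) ^ 2 - D : ℚ) ≠ 0 := by convert ex using 2; ring
    have e4 : ((-1 / 2 - n) ^ 2 - D : ℚ) = (1 / 2 + n) ^ 2 - D := by ring
    simp only [e4]
    have p1 : (-(n + 1) * (n + 1 + b) * (n + b) * b * ((1 / 2 + n) ^ 2 - D)) *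
        ((3 * k - n - 1) * (b + k) * (-(n + b) / 2 + k) *
          ((-1 / 2 - n + k) ^ 2 - D) / (b * (-(n + b) / 2) * ((1 / 2 + n) ^ 2 - D))) =
        2 * (n + 1) * (n + 1 + b) * ((3 * k - n - 1) * (b + k) * (-(n + b) / 2 + k) *
          ((-1 / 2 - n + k) ^ 2 - D)) := by
      generalize ((-1 / 2 - n + k) ^ 2 - D : ℚ) = w1 at *
      generalize ((1 / 2 + n) ^ 2 - D : ℚ) = w2 at *
      field_simp
    have p0 : (b * (n + 1) ^ 3 * (D - (n + 1 / 2 + b) ^ 2)) *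
        ((3 * k - n) * (n + 1 - k) ^ 2 * (n + 1 + k) * (b - k) / ((n + 1) ^ 3 * b)) =
        (D - (n + 1 / 2 + b) ^ 2) * ((3 * k - n) * (n + 1 - k) ^ 2 * (n + 1 + k) * (b - k)) := by
      field_simp
    rw [p1, p0]
    push_cast
    ring

theorem sum_nullTerm (n : ℕ) (i e : ℤ) {b D : ℚ} (hb : b = i + 1 / 2) (hD : D = e ^ 2) :
    ∑ k ∈ Finset.range (n + 1), nullTerm n b D k = 0 := by
  induction n generalizing b i with
  | zero => simp [nullTerm]
  | succ n ih =>
    have hb' : b - 1 = (i - 1 : ℤ) + 1 / 2 := by rw [hb]; push_cast; ring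
    have hs := sum_nullTerm_succ n (i - 1) e hb' hD
    rw [ih (i - 1) hb', mul_zero, sub_add_cancel] at hs
    refine (mul_eq_zero.1 hs).resolve_left ?_
    have h1 : (-(n + 1) : ℚ) ≠ 0 := by
      rw [neg_ne_zero]
      positivity
    have h2 : n + 1 + (b - 1) ≠ 0 := half_odd_ne_zero (n + i) (by rw [hb]; push_cast; ring)
    have h3 : n + (b - 1) ≠ 0 := half_odd_ne_zero (n - 1 + i) (by rw [hb]; push_cast; ring)
    have h4 : b - 1 ≠ 0 := half_odd_ne_zero (i - 1) (by rw [hb]; push_cast; ring)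
    have h5 : (1 / 2 + n : ℚ) ^ 2 - D ≠ 0 := by
      rw [hD]
      exact sq_sub_sq_ne_zero (half_odd_ne_zero (n - e) (by push_cast; ring))
        (half_odd_ne_zero (n + e) (by push_cast; ring))
    exact mul_ne_zero (mul_ne_zero (mul_ne_zero (mul_ne_zero h1 h2) h3) h4) h5

/-- The rational number `x` is divisible by `p ^ j` in the `p`-adic integers. -/
def PDiv (p : ℕ) [Fact p.Prime] (j : ℕ) (x : ℚ) : Prop := ‖(x : ℚ_[p])‖ ≤ (p : ℝ)⁻¹ ^ j

/-- The rational number `x` is a unit of the `p`-adic integers. -/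
def PAdicUnit (p : ℕ) [Fact p.Prime] (x : ℚ) : Prop := ‖(x : ℚ_[p])‖ = 1

section PadicDivisibility

variable {p : ℕ} [Fact p.Prime]

theorem PDiv.mono {i j : ℕ} {x : ℚ} (h : PDiv p j x) (hij : i ≤ j) : PDiv p i x :=
  h.trans <| pow_le_pow_of_le_one (by positivity)
    (inv_le_one_of_one_le₀ (by exact_mod_cast (Fact.out : p.Prime).one_le)) hij

theorem PDiv.zero (j : ℕ) : PDiv p j 0 := by
  rw [PDiv, Rat.cast_zero, norm_zero]
  positivity

theorem PDiv.add {j : ℕ} {x y : ℚ} (hx : PDiv p j x) (hy : PDiv p j y) : PDiv p j (x + y) := by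
  rw [PDiv, Rat.cast_add]
  exact (Padic.nonarchimedean _ _).trans (max_le hx hy)

theorem PDiv.neg {j : ℕ} {x : ℚ} (hx : PDiv p j x) : PDiv p j (-x) := by
  rwa [PDiv, Rat.cast_neg, norm_neg]

theorem PDiv.sub {j : ℕ} {x y : ℚ} (hx : PDiv p j x) (hy : PDiv p j y) : PDiv p j (x - y) := by
  rw [sub_eq_add_neg]
  exact hx.add hy.neg

theorem PDiv.mul {i j : ℕ} {x y : ℚ} (hx : PDiv p i x) (hy : PDiv p j y) :
    PDiv p (i + j) (x * y) := by
  rw [PDiv, Rat.cast_mul, norm_mul, pow_add]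
  exact mul_le_mul hx hy (norm_nonneg _) (by positivity)

theorem PDiv.sum {ι : Type*} {s : Finset ι} {f : ι → ℚ} {j : ℕ} (h : ∀ i ∈ s, PDiv p j (f i)) :
    PDiv p j (∑ i ∈ s, f i) :=
  Finset.sum_induction _ _ (fun _ _ => PDiv.add) (PDiv.zero j) h

theorem PDiv.prime : PDiv p 1 p := by
  simp [PDiv]

theorem PDiv.natCast (m : ℕ) : PDiv p 0 m := by
  simpa [PDiv] using Padic.norm_int_le_one (p := p) m

theorem PAdicUnit.pDiv {x : ℚ} (h : PAdicUnit p x) : PDiv p 0 x := by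
  rw [PDiv, pow_zero]
  exact h.le

theorem PAdicUnit.ne_zero {x : ℚ} (h : PAdicUnit p x) : x ≠ 0 := by
  rintro rfl
  simp [PAdicUnit] at h

theorem PAdicUnit.mul {x y : ℚ} (hx : PAdicUnit p x) (hy : PAdicUnit p y) : PAdicUnit p (x * y) := by
  rw [PAdicUnit, Rat.cast_mul, norm_mul, hx, hy, one_mul]

theorem PAdicUnit.inv {x : ℚ} (hx : PAdicUnit p x) : PAdicUnit p x⁻¹ := by
  rw [PAdicUnit, Rat.cast_inv, norm_inv, hx, inv_one]

theorem PDiv.div {j : ℕ} {x y : ℚ} (hx : PDiv p j x) (hy : PAdicUnit p y) : PDiv p j (x / y) := by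
  rw [div_eq_mul_inv]
  exact hx.mul hy.inv.pDiv

theorem PAdicUnit.of_sub {x y : ℚ} (hx : PAdicUnit p x) (h : PDiv p 1 (y - x)) : PAdicUnit p y := by
  have hlt : ‖((y - x : ℚ) : ℚ_[p])‖ < ‖(x : ℚ_[p])‖ := by
    rw [hx]
    refine lt_of_le_of_lt h ?_
    rw [pow_one]
    exact inv_lt_one_of_one_lt₀ (by exact_mod_cast (Fact.out : p.Prime).one_lt)
  have := Padic.add_eq_max_of_ne hlt.ne
  rw [max_eq_right hlt.le, ← Rat.cast_add, sub_add_cancel] at this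
  exact this.trans hx

theorem PAdicUnit.natCast {m : ℕ} (h0 : 0 < m) (h : m < p) : PAdicUnit p m := by
  rw [PAdicUnit, Rat.cast_natCast, Padic.norm_natCast_eq_one_iff]
  exact (Nat.coprime_of_lt_prime h0.ne' h Fact.out)

theorem PAdicUnit.two (hp : p % 4 = 3) : PAdicUnit p 2 := by
  exact_mod_cast PAdicUnit.natCast (p := p) (m := 2) (by norm_num) (by omega)

theorem PDiv.sub_inv {j : ℕ} {x y : ℚ} (hx : PAdicUnit p x) (hy : PAdicUnit p y)
    (h : PDiv p j (x - y)) : PDiv p j (x⁻¹ - y⁻¹) := by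
  have := hx.ne_zero
  have := hy.ne_zero
  have e : x⁻¹ - y⁻¹ = -(x - y) / (x * y) := by field_simp; ring
  rw [e]
  exact h.neg.div (hx.mul hy)

theorem PDiv.prod_zero {ι : Type*} {s : Finset ι} {f : ι → ℚ} (h : ∀ i ∈ s, PDiv p 0 (f i)) :
    PDiv p 0 (∏ i ∈ s, f i) :=
  Finset.prod_induction _ _ (fun _ _ => PDiv.mul) (by simpa using PDiv.natCast (p := p) 1) h

theorem PDiv.prod_of_mem {ι : Type*} [DecidableEq ι] {s : Finset ι} {f : ι → ℚ} {j : ℕ} {i : ι}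
    (hi : i ∈ s) (h : ∀ i ∈ s, PDiv p 0 (f i)) (hj : PDiv p j (f i)) :
    PDiv p j (∏ i ∈ s, f i) := by
  rw [← Finset.mul_prod_erase s f hi]
  exact hj.mul (PDiv.prod_zero fun i hi => h i (Finset.mem_of_mem_erase hi))

theorem PDiv.prod_sub_prod {ι : Type*} [DecidableEq ι] {s : Finset ι} {f g : ι → ℚ} {j : ℕ}
    (hf : ∀ i ∈ s, PDiv p 0 (f i)) (hg : ∀ i ∈ s, PDiv p 0 (g i))
    (h : ∀ i ∈ s, PDiv p j (f i - g i)) : PDiv p j (∏ i ∈ s, f i - ∏ i ∈ s, g i) := by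
  induction s using Finset.induction_on with
  | empty => simpa using PDiv.zero j
  | insert i s hi ih =>
    rw [Finset.forall_mem_insert] at hf hg h
    rw [Finset.prod_insert hi, Finset.prod_insert hi,
      show f i * ∏ i ∈ s, f i - g i * ∏ i ∈ s, g i =
        (∏ i ∈ s, f i) * (f i - g i) + g i * (∏ i ∈ s, f i - ∏ i ∈ s, g i) by ring]
    have h1 := (PDiv.prod_zero hf.2).mul h.1
    have h2 := hg.1.mul (ih hf.2 hg.2 h.2)
    rw [zero_add] at h1 h2
    exact h1.add h2

/-- Modulo `p`, `a` agrees with `a'`, and `a - b`, `a' - b'` are multiples of `p²` with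
`a - b ≡ c (a' - b')` modulo `p³`. -/
structure SameVariation (p : ℕ) [Fact p.Prime] (c a b a' b' : ℚ) : Prop where
  left : PDiv p 0 a
  right : PDiv p 0 b
  cross : PDiv p 1 (a - a')
  diff : PDiv p 2 (a - b)
  diff' : PDiv p 2 (a' - b')
  var : PDiv p 3 (a - b - c * (a' - b'))

theorem SameVariation.mul {c A B A' B' a b a' b' : ℚ} (hc : PDiv p 0 c)
    (H : SameVariation p c A B A' B') (h : SameVariation p c a b a' b') :
    SameVariation p c (A * a) (B * b) (A' * a') (B' * b') := by
  have hA' : PDiv p 0 A' := by simpa using H.left.sub (H.cross.mono zero_le_one)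
  have hb' : PDiv p 0 b' := by
    simpa using (h.left.sub (h.cross.mono zero_le_one)).sub (h.diff'.mono zero_le_two)
  refine ⟨H.left.mul h.left, H.right.mul h.right, ?_, ?_, ?_, ?_⟩
  · rw [show A * a - A' * a' = (A - A') * a + A' * (a - a') by ring]
    simpa using (H.cross.mul h.left).add (by simpa using hA'.mul h.cross)
  · rw [show A * a - B * b = (A - B) * a + B * (a - b) by ring]
    simpa using (H.diff.mul h.left).add (by simpa using H.right.mul h.diff)
  · rw [show A' * a' - B' * b' = (A' - B') * b' + A' * (a' - b') by ring]
    simpa using (H.diff'.mul hb').add (by simpa using hA'.mul h.diff')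
  · rw [show A * a - B * b - c * (A' * a' - B' * b') =
      (A - B - c * (A' - B')) * a + c * ((A' - B') * (a - a')) +
        (B * (a - b - c * (a' - b')) + c * (((A - A') - (A - B) + (A' - B')) * (a' - b'))) by ring]
    have h1 : PDiv p 3 ((A - B - c * (A' - B')) * a) := H.var.mul h.left
    have h2 : PDiv p (0 + 3) (c * ((A' - B') * (a - a'))) := hc.mul (H.diff'.mul h.cross)
    have h3 : PDiv p (0 + 3) (B * (a - b - c * (a' - b'))) := H.right.mul h.var
    have h4 : PDiv p (0 + 3) (c * (((A - A') - (A - B) + (A' - B')) * (a' - b'))) :=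
      hc.mul (((H.cross.sub (H.diff.mono one_le_two)).add (H.diff'.mono one_le_two)).mul h.diff')
    rw [zero_add] at h2 h3 h4
    exact (h1.add h2).add (h3.add h4)

theorem SameVariation.prod {ι : Type*} {s : Finset ι} {c : ℚ} {a b a' b' : ι → ℚ}
    (hc : PDiv p 0 c) (h : ∀ i ∈ s, SameVariation p c (a i) (b i) (a' i) (b' i)) :
    SameVariation p c (∏ i ∈ s, a i) (∏ i ∈ s, b i) (∏ i ∈ s, a' i) (∏ i ∈ s, b' i) := by
  classical
  induction s using Finset.induction_on with
  | empty =>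
    have h1 : PDiv p 0 1 := by simpa using PDiv.natCast (p := p) 1
    constructor <;> simp [h1, PDiv.zero]
  | insert i s hi ih =>
    rw [Finset.forall_mem_insert] at h
    simp only [Finset.prod_insert hi]
    exact h.1.mul hc (ih h.2)

theorem SameVariation.div {c x d d' s t : ℚ} (hc : PDiv p 0 c) (hx : PDiv p 0 x)
    (hd : PAdicUnit p d) (hdd : PDiv p 1 (d - d')) (hs : PDiv p 2 s) (ht : PDiv p 2 t) :
    SameVariation p c (x / d) ((x - c * s) / (d - c * t)) (x / d') ((x - s) / (d' - t)) := by
  have hd' : PAdicUnit p d' := hd.of_sub (by simpa using hdd.neg)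
  have hcs : PDiv p (0 + 2) (c * s) := hc.mul hs
  have hct : PDiv p (0 + 2) (c * t) := hc.mul ht
  rw [zero_add] at hcs hct
  have he : PAdicUnit p (d - c * t) := hd.of_sub (by simpa using (hct.mono one_le_two).neg)
  have he' : PAdicUnit p (d' - t) := hd'.of_sub (by simpa using (ht.mono one_le_two).neg)
  have hee : PDiv p 1 ((d - c * t) - (d' - t)) := by
    rw [show (d - c * t) - (d' - t) = (d - d') - c * t + t by ring]
    exact (hdd.sub (hct.mono one_le_two)).add (ht.mono one_le_two)
  generalize hw : d - c * t = e at *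
  generalize hw' : d' - t = e' at *
  have n1 := hd.ne_zero
  have n2 := hd'.ne_zero
  have n3 := he.ne_zero
  have n4 := he'.ne_zero
  have key : x / d - (x - c * s) / e = c * s / e - x * (c * t) / (d * e) := by
    rw [show c * t = d - e by rw [← hw]; ring]
    field_simp
    ring
  have key' : x / d' - (x - s) / e' = s / e' - x * t / (d' * e') := by
    rw [show t = d' - e' by rw [← hw']; ring]
    field_simp
    ring
  have hxt : PDiv p (0 + 2) (x * t) := hx.mul ht
  have hxct : PDiv p (0 + 2) (x * (c * t)) := hx.mul hct
  rw [zero_add] at hxt hxct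
  refine ⟨hx.div hd, (hx.sub (hcs.mono zero_le_two)).div he, ?_, ?_, ?_, ?_⟩
  · rw [div_eq_mul_inv, div_eq_mul_inv, ← mul_sub]
    simpa using hx.mul (PDiv.sub_inv hd hd' hdd)
  · rw [key]
    exact (hcs.div he).sub (hxct.div (hd.mul he))
  · rw [key']
    exact (hs.div he').sub (hxt.div (hd'.mul he'))
  · rw [key, key', show c * s / e - x * (c * t) / (d * e) - c * (s / e' - x * t / (d' * e')) =
      c * s * (e⁻¹ - e'⁻¹) - x * (c * t) * ((d * e)⁻¹ - (d' * e')⁻¹) by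
        simp only [div_eq_mul_inv]; ring]
    refine (hcs.mul (PDiv.sub_inv he he' hee)).sub
      (hxct.mul (PDiv.sub_inv (hd.mul he) (hd'.mul he') ?_))
    rw [show d * e - d' * e' = (d - d') * e + d' * (e - e') by ring]
    simpa using (hdd.mul he.pDiv).add (by simpa using hd'.pDiv.mul hee)

end PadicDivisibility

/-- The analogue of `uFac` in `nullTerm` for `n = (p - 1) / 2`. -/
def uNull (p : ℕ) (B : ℚ) (k : ℕ) : ℚ := pairFac (1 / 2) B k / pairFac (1 - p / 4) (B / 4) k

/-- The analogue of `vFac` in `nullTerm` for `n = (p - 1) / 2`. -/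
def vNull (p : ℕ) (D : ℚ) (k : ℕ) : ℚ := pairFac (1 / 4) (D / 4) k / pairFac (1 - p / 2) D k

/-- The analogue of `cFac` in `nullTerm`. -/
def cNull (n k : ℕ) : ℚ :=
  (3 * k - n) * (risingFac (-n) k ^ 2 / (k.factorial * risingFac (n + 1) k))

theorem nullTerm_eq {p n : ℕ} (hn : (n : ℚ) = (p - 1) / 2) (β D : ℚ) (k : ℕ) :
    nullTerm n (1 / 2 + β) D k = cNull n k * uNull p (β ^ 2) k * vNull p D k := by
  rw [nullTerm, cNull, uNull, vNull, show β ^ 2 / 4 = (β / 2) ^ 2 by ring, pairFac_sq, pairFac_sq,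
    show 1 - (1 / 2 + β) = 1 / 2 - β by ring, show (1 / 2 - n : ℚ) = 1 - p / 2 by rw [hn]; ring,
    show 1 - (n + (1 / 2 + β)) / 2 = 1 - p / 4 - β / 2 by rw [hn]; ring,
    show (1 + (1 / 2 + β) - n) / 2 = 1 - p / 4 + β / 2 by rw [hn]; ring]
  simp only [div_eq_mul_inv, mul_inv]
  ring

theorem sum_cNull_variation {p n : ℕ} (hn : (n : ℚ) = (p - 1) / 2) :
    ∑ k ∈ Finset.range (n + 1), cNull n k * (uNull p 0 k - uNull p (p ^ 2) k) *
      (vNull p 0 k - vNull p (p ^ 2) k) = 0 := by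
  have h (i e : ℕ) : ∑ k ∈ Finset.range (n + 1),
      cNull n k * uNull p (i ^ 2) k * vNull p (e ^ 2) k = 0 := by
    simpa only [nullTerm_eq hn] using
      sum_nullTerm n i e (b := 1 / 2 + i) (D := e ^ 2) (by push_cast; ring) (by push_cast; ring)
  have h00 := h 0 0
  have h0p := h 0 p
  have hp0 := h p 0
  have hpp := h p p
  rw [Nat.cast_zero, zero_pow two_ne_zero] at h00 h0p hp0
  calc _ = ∑ k ∈ Finset.range (n + 1), (cNull n k * uNull p 0 k * vNull p 0 k -
        cNull n k * uNull p 0 k * vNull p (p ^ 2) k - cNull n k * uNull p (p ^ 2) k * vNull p 0 k +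
        cNull n k * uNull p (p ^ 2) k * vNull p (p ^ 2) k) :=
      Finset.sum_congr rfl fun k _ => by ring
    _ = 0 := by
      rw [Finset.sum_add_distrib, Finset.sum_sub_distrib, Finset.sum_sub_distrib, h00, h0p, hp0,
        hpp]
      norm_num

section Congruences

variable {p : ℕ} [Fact p.Prime]

theorem PAdicUnit.one_add {j : ℕ} (h : j + 1 < p) : PAdicUnit p (1 + j) := by
  have := PAdicUnit.natCast (p := p) j.succ_pos h
  rwa [Nat.cast_succ, add_comm] at this

theorem pDiv_half (hp : p % 4 = 3) (m : ℕ) : PDiv p 0 (m / 2) :=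
  (PDiv.natCast m).div (PAdicUnit.two hp)

theorem pDiv_quarter (hp : p % 4 = 3) (m : ℕ) : PDiv p 0 (m / 4) := by
  rw [show (4 : ℚ) = 2 * 2 by norm_num]
  exact (PDiv.natCast m).div ((PAdicUnit.two hp).mul (PAdicUnit.two hp))

theorem pDiv_prime_sq : PDiv p 2 (p ^ 2) := by
  rw [sq]
  exact PDiv.prime.mul PDiv.prime

theorem pairFac_div_pairFac (x y B C : ℚ) (k : ℕ) :
    pairFac x B k / pairFac y C k =
      ∏ j ∈ Finset.range k, ((x + j) ^ 2 - B) / ((y + j) ^ 2 - C) :=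
  (Finset.prod_div_distrib ..).symm

theorem sameVariation_pairFac {c x y s t : ℚ} {k : ℕ} (hk : k < p) (hc : PDiv p 0 c)
    (hx : PDiv p 0 x) (hy : PDiv p 1 (1 - y)) (hs : PDiv p 2 s) (ht : PDiv p 2 t) :
    SameVariation p c (pairFac x 0 k / pairFac 1 0 k)
      (pairFac x (c * s) k / pairFac 1 (c * t) k) (pairFac x 0 k / pairFac y 0 k)
      (pairFac x s k / pairFac y t k) := by
  simp only [pairFac_div_pairFac, sub_zero]
  refine SameVariation.prod hc fun j hj => ?_
  have hu : PAdicUnit p (1 + j) := PAdicUnit.one_add (by have := Finset.mem_range.1 hj; omega)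
  have hxj : PDiv p 0 (x + j) := hx.add (PDiv.natCast j)
  have h1 : PDiv p 0 (1 : ℚ) := by simpa using PDiv.natCast (p := p) 1
  have hyj : PDiv p 0 (1 + j + (y + j)) := by
    rw [show 1 + j + (y + j) = 1 + j + (1 - (1 - y) + j) by ring]
    exact hu.pDiv.add ((h1.sub (hy.mono zero_le_one)).add (PDiv.natCast j))
  refine SameVariation.div hc ?_ ?_ ?_ hs ht
  · rw [sq]
    exact hxj.mul hxj
  · rw [sq]
    exact hu.mul hu
  · rw [show (1 + j : ℚ) ^ 2 - (y + j) ^ 2 = (1 - y) * (1 + j + (y + j)) by ring]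
    exact hy.mul hyj

theorem sameVariation_uFac (hp : p % 4 = 3) {k : ℕ} (hk : k < p) :
    SameVariation p (1 / 4) (uFac 0 k) (uFac (p ^ 2 / 4) k) (uNull p 0 k)
      (uNull p (p ^ 2) k) := by
  have h4 : PDiv p 0 (1 / 4) := by simpa using pDiv_quarter hp 1
  have h2 : PDiv p 0 (1 / 2) := by simpa using pDiv_half hp 1
  have := sameVariation_pairFac (y := 1 - p / 4) (s := p ^ 2) (t := p ^ 2 / 4) hk h4 h2
    (by
      rw [show 1 - (1 - (p : ℚ) / 4) = p * (1 / 4) by ring]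
      exact PDiv.prime.mul h4)
    pDiv_prime_sq
    (by
      rw [div_eq_mul_one_div]
      exact pDiv_prime_sq.mul h4)
  rw [uFac, uFac, uNull, uNull, zero_div]
  convert this using 3 <;> ring

theorem sameVariation_vFac (hp : p % 4 = 3) {k : ℕ} (hk : k < p) :
    SameVariation p (9 / 4) (vFac 0 k) (vFac (9 * p ^ 2 / 4) k) (vNull p 0 k)
      (vNull p (p ^ 2) k) := by
  have h4 : PDiv p 0 (1 / 4) := by simpa using pDiv_quarter hp 1
  have h9 : PDiv p 0 (9 / 4) := by simpa using pDiv_quarter hp 9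
  have h2 : PDiv p 0 (1 / 2) := by simpa using pDiv_half hp 1
  have := sameVariation_pairFac (y := 1 - p / 2) (s := p ^ 2 / 4) (t := p ^ 2) hk h9 h4
    (by
      rw [show 1 - (1 - (p : ℚ) / 2) = p * (1 / 2) by ring]
      exact PDiv.prime.mul h2)
    (by
      rw [div_eq_mul_one_div]
      exact pDiv_prime_sq.mul h4)
    pDiv_prime_sq
  rw [vFac, vFac, vNull, vNull, zero_div]
  convert this using 3 <;> ring

theorem cFac_eq_prod (k : ℕ) :
    cFac k = (6 * k + 1) * ∏ j ∈ Finset.range k, (1 / 2 + j : ℚ) / (1 + j) := by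
  rw [cFac, ← risingFac_one, risingFac, risingFac, Finset.prod_div_distrib]

theorem cNull_eq_prod (n k : ℕ) :
    cNull n k = (3 * k - n) *
      ∏ j ∈ Finset.range k, (-n + j : ℚ) ^ 2 / ((1 + j) * (n + 1 + j)) := by
  rw [cNull, ← risingFac_one, risingFac, risingFac, risingFac, Finset.prod_div_distrib,
    Finset.prod_mul_distrib, Finset.prod_pow]

theorem pDiv_cFac_factor (hp : p % 4 = 3) {j : ℕ} (h : j + 1 < p) :
    PDiv p 0 ((1 / 2 + j : ℚ) / (1 + j)) := by
  have h2 : PDiv p 0 (1 / 2) := by simpa using pDiv_half hp 1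
  exact (h2.add (PDiv.natCast j)).div (PAdicUnit.one_add h)

theorem pDiv_linear (a b k : ℕ) : PDiv p 0 (a * k + b) :=
  ((PDiv.natCast a).mul (PDiv.natCast k)).add (PDiv.natCast b)

theorem pDiv_cFac (hp : p % 4 = 3) {k : ℕ} (hk : k < p) : PDiv p 0 (cFac k) := by
  rw [cFac_eq_prod]
  refine PDiv.mul (by simpa using pDiv_linear (p := p) 6 1 k) (PDiv.prod_zero fun j hj => ?_)
  exact pDiv_cFac_factor hp (by have := Finset.mem_range.1 hj; omega)

theorem pDiv_cFac_of_lt (hp : p % 4 = 3) {n k : ℕ} (hn : (n : ℚ) = (p - 1) / 2) (hnk : n < k)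
    (hk : k < p) : PDiv p 1 (cFac k) := by
  rw [cFac_eq_prod]
  refine PDiv.mul (i := 0) (j := 1) (by simpa using pDiv_linear (p := p) 6 1 k)
    (PDiv.prod_of_mem (Finset.mem_range.2 hnk) (fun j hj => ?_) ?_)
  · exact pDiv_cFac_factor hp (by have := Finset.mem_range.1 hj; omega)
  · rw [show (1 / 2 + n : ℚ) = p * (1 / 2) by rw [hn]; ring]
    refine PDiv.div (PDiv.mul (j := 0) PDiv.prime ?_) (PAdicUnit.one_add (by omega))
    simpa using pDiv_half hp 1

theorem pDiv_cFac_sub_cNull (hp : p % 4 = 3) {n k : ℕ} (hn : (n : ℚ) = (p - 1) / 2)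
    (hk : k ≤ n) : PDiv p 1 (cFac k - 2 * cNull n k) := by
  have hnp : 2 * n + 1 = p := by
    exact_mod_cast (by rw [hn]; ring : (2 * n + 1 : ℚ) = p)
  have h2 : PDiv p 0 (1 / 2) := by simpa using pDiv_half hp 1
  have hP : PDiv p 1 (p / 2 : ℚ) := by
    rw [div_eq_mul_one_div]
    exact PDiv.prime.mul h2
  have hneg (j : ℕ) : PDiv p 0 (-n + j : ℚ) := (PDiv.natCast n).neg.add (PDiv.natCast j)
  have hu (j : ℕ) (hj : j ∈ Finset.range k) : PAdicUnit p ((1 + j) * (n + 1 + j)) := by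
    have := Finset.mem_range.1 hj
    refine (PAdicUnit.one_add (by omega)).mul ?_
    exact_mod_cast PAdicUnit.natCast (p := p) (m := n + 1 + j) (by omega) (by omega)
  have hf (j : ℕ) (hj : j ∈ Finset.range k) : PDiv p 0 ((1 / 2 + j : ℚ) / (1 + j)) :=
    pDiv_cFac_factor hp (by have := Finset.mem_range.1 hj; omega)
  have key := PDiv.prod_sub_prod (p := p) (s := Finset.range k) (j := 1)
    (f := fun j => (1 / 2 + j : ℚ) / (1 + j))
    (g := fun j => (-n + j : ℚ) ^ 2 / ((1 + j) * (n + 1 + j))) hf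
    (fun j hj => by
      rw [sq]
      exact ((hneg j).mul (hneg j)).div (hu j hj))
    (fun j hj => by
      have e1 : (1 + j : ℚ) ≠ 0 := by positivity
      have e2 : (n + 1 + j : ℚ) ≠ 0 := by positivity
      have e : (1 / 2 + j : ℚ) / (1 + j) - (-n + j) ^ 2 / ((1 + j) * (n + 1 + j)) =
          p / 2 * (1 + j + j + j + 1 / 2 - p / 2) / ((1 + j) * (n + 1 + j)) := by
        rw [show (p : ℚ) = 2 * n + 1 by exact_mod_cast hnp.symm]
        field_simp
        ring
      rw [e]
      refine PDiv.div (hP.mul (j := 0) ?_) (hu j hj)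
      have hj0 := PDiv.natCast (p := p) j
      have h1 : PDiv p 0 (1 : ℚ) := by simpa using PDiv.natCast (p := p) 1
      exact ((((h1.add hj0).add hj0).add hj0).add h2).sub (hP.mono zero_le_one))
  rw [cFac_eq_prod, cNull_eq_prod,
    show ∀ a b : ℚ, (6 * k + 1) * a - 2 * ((3 * k - n) * b) =
      p * a + 2 * (3 * k - n) * (a - b) by intro a b; rw [hn]; ring]
  refine (PDiv.prime.mul (j := 0) (PDiv.prod_zero hf)).add (PDiv.mul (i := 0) (j := 1) ?_ key)
  exact (PAdicUnit.two hp).pDiv.mul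
    ((by simpa using pDiv_linear (p := p) 3 0 k : PDiv p 0 (3 * k)).sub (PDiv.natCast n))

theorem pDiv_mul_variation {c c' u u' v v' : ℚ} (h4 : PDiv p 0 (1 / 4))
    (hc' : PDiv p 0 (2 * c')) (hc : PDiv p 1 (c - 2 * c')) (hu : PDiv p 2 u) (hv : PDiv p 2 v)
    (hu' : PDiv p 2 u') (huu : PDiv p 3 (u - 1 / 4 * u')) (hvv : PDiv p 3 (v - 9 / 4 * v')) :
    PDiv p 5 (c * u * v - 2 * (1 / 4) * (9 / 4) * (c' * u' * v')) := by
  rw [show c * u * v - 2 * (1 / 4) * (9 / 4) * (c' * u' * v') =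
    (c - 2 * c') * u * v + 2 * c' * (u - 1 / 4 * u') * v +
      2 * c' * (1 / 4) * u' * (v - 9 / 4 * v') by ring]
  have h1 : PDiv p (1 + 2 + 2) ((c - 2 * c') * u * v) := (hc.mul hu).mul hv
  have h2 : PDiv p (0 + 3 + 2) (2 * c' * (u - 1 / 4 * u') * v) := (hc'.mul huu).mul hv
  have h3 : PDiv p (0 + 0 + 2 + 3) (2 * c' * (1 / 4) * u' * (v - 9 / 4 * v')) :=
    ((hc'.mul h4).mul hu').mul hvv
  exact (h1.add h2).add h3

theorem pDiv_sum_variation (hp : p % 4 = 3) {n : ℕ} (hn : (n : ℚ) = (p - 1) / 2) :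
    PDiv p 5 (∑ k ∈ Finset.range p, cFac k * (uFac 0 k - uFac (p ^ 2 / 4) k) *
      (vFac 0 k - vFac (9 * p ^ 2 / 4) k)) := by
  have hnp : 2 * n + 1 = p := by
    exact_mod_cast (by rw [hn]; ring : (2 * n + 1 : ℚ) = p)
  rw [← Finset.sum_range_add_sum_Ico _ (show n + 1 ≤ p by omega)]
  refine PDiv.add ?_ (PDiv.sum fun k hk => ?_)
  · have h0 (f : ℕ → ℚ) : ∑ k ∈ Finset.range (n + 1), f k =
        ∑ k ∈ Finset.range (n + 1), (f k - 2 * (1 / 4) * (9 / 4) * (cNull n k *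
          (uNull p 0 k - uNull p (p ^ 2) k) * (vNull p 0 k - vNull p (p ^ 2) k))) := by
      rw [Finset.sum_sub_distrib, ← Finset.mul_sum, sum_cNull_variation hn, mul_zero, sub_zero]
    rw [h0]
    refine PDiv.sum fun k hk => ?_
    have hkn : k ≤ n := Nat.lt_succ_iff.1 (Finset.mem_range.1 hk)
    have hkp : k < p := by omega
    have hu := sameVariation_uFac hp hkp
    have hv := sameVariation_vFac hp hkp
    have hc := pDiv_cFac_sub_cNull hp hn hkn
    have hc' : PDiv p 0 (2 * cNull n k) := by
      simpa using (pDiv_cFac hp hkp).sub (hc.mono zero_le_one)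
    exact pDiv_mul_variation (by simpa using pDiv_quarter hp 1) hc' hc hu.diff hv.diff hu.diff' hu.var hv.var
  · obtain ⟨h1, h2⟩ := Finset.mem_Ico.1 hk
    exact ((pDiv_cFac_of_lt hp hn (by omega) h2).mul (sameVariation_uFac hp h2).diff).mul
      (sameVariation_vFac hp h2).diff

end Congruences

theorem sum_range_eq_of_terminating {f : ℕ → ℚ} {m n : ℕ} (h : ∀ k, m < k → f k = 0)
    (hmn : m < n) : ∑ k ∈ Finset.range n, f k = ∑ k ∈ Finset.range (m + 1), f k :=
  Finset.eventually_constant_sum (fun k hk => h k hk) hmn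

theorem sum_cFac_uFac_vFac_eq {p q : ℕ} (hq : p = 4 * q + 3) (B : ℚ)
    (hB : ∀ j : ℕ, (1 + j : ℚ) ^ 2 - B / 4 ≠ 0) :
    ∑ k ∈ Finset.range p, cFac k * uFac B k * vFac (9 * p ^ 2 / 4) k =
      3 * p * ∏ j ∈ Finset.range (3 * q + 2),
        ((1 / 2 + j : ℚ) ^ 2 - B / 4) / ((1 + j) ^ 2 - B / 4) := by
  have hp : (p : ℚ) = 4 * q + 3 := by exact_mod_cast hq
  have hD : (9 * p ^ 2 / 4 : ℚ) = (2 * (3 * q + 2 : ℕ) + 1 / 2) ^ 2 := by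
    rw [hp]
    push_cast
    ring
  rw [hD, sum_range_eq_of_terminating (m := 3 * q + 2) _ (by omega),
    sum_uFac_vFac_terminating B hB, show (4 * (3 * q + 2 : ℕ) + 1 : ℚ) = 3 * p by
      rw [hp]; push_cast; ring]
  intro k hk
  rw [vFac_terminating, risingFac_neg_natCast_eq_zero hk]
  simp

theorem sum_cFac_uFac_vFac_zero {p q : ℕ} (hq : p = 4 * q + 3) :
    ∑ k ∈ Finset.range p, cFac k * uFac (p ^ 2 / 4) k * vFac 0 k = 0 := by
  have hB : (p ^ 2 / 4 : ℚ) = ((2 * q + 1 : ℕ) + 1 / 2) ^ 2 := by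
    rw [hq]
    push_cast
    ring
  rw [hB, sum_range_eq_of_terminating (m := 2 * q + 1) _ (by omega), sum_uFac_vFac_zero_of_odd]
  intro k hk
  rw [uFac_terminating, risingFac_neg_natCast_eq_zero hk]
  simp

theorem pDiv_prod_sub_prod {p q : ℕ} [Fact p.Prime] (hq : p = 4 * q + 3) :
    PDiv p 4 (3 / 4 * ∏ j ∈ Finset.range (3 * q + 2), ((1 / 2 + j : ℚ) ^ 2 / (1 + j) ^ 2) -
      ∏ j ∈ Finset.range (3 * q + 2),
        ((1 / 2 + j : ℚ) ^ 2 - p ^ 2 / 16) / ((1 + j) ^ 2 - p ^ 2 / 16)) := by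
  have hp : p % 4 = 3 := by omega
  have h1 : PDiv p 0 (1 : ℚ) := by simpa using PDiv.natCast (p := p) 1
  have h2 : PDiv p 0 (1 / 2) := by simpa using pDiv_half hp 1
  have h4 : PDiv p 0 (1 / 4) := by simpa using pDiv_quarter hp 1
  have h16 : PDiv p 2 (p ^ 2 / 16 : ℚ) := by
    rw [show (p ^ 2 / 16 : ℚ) = p ^ 2 * (1 / 4 * (1 / 4)) by ring]
    exact pDiv_prime_sq.mul (h4.mul h4)
  have hx (j : ℕ) : PDiv p 0 ((1 / 2 + j : ℚ) ^ 2) := by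
    rw [sq]
    exact (h2.add (PDiv.natCast j)).mul (h2.add (PDiv.natCast j))
  have hd (j : ℕ) (hj : j ∈ Finset.range (3 * q + 2)) : PAdicUnit p ((1 + j : ℚ) ^ 2) := by
    have := Finset.mem_range.1 hj
    rw [sq]
    exact (PAdicUnit.one_add (by omega)).mul (PAdicUnit.one_add (by omega))
  have he (j : ℕ) (hj : j ∈ Finset.range (3 * q + 2)) :
      PAdicUnit p ((1 + j : ℚ) ^ 2 - p ^ 2 / 16) :=
    (hd j hj).of_sub (by simpa using (h16.mono one_le_two).neg)
  have hs (j : ℕ) (hj : j ∈ Finset.range (3 * q + 2)) :=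
    SameVariation.div (d' := (1 + j : ℚ) ^ 2) h1 (hx j) (hd j hj) (by simpa using PDiv.zero 1)
      h16 h16
  simp only [one_mul] at hs
  have hmem : 2 * q + 1 ∈ Finset.range (3 * q + 2) := Finset.mem_range.2 (by omega)
  have hn : (1 / 2 + (2 * q + 1 : ℕ) : ℚ) = p * (1 / 2) := by
    rw [hq]
    push_cast
    ring
  rw [← Finset.mul_prod_erase _ _ hmem, ← Finset.mul_prod_erase _ _ hmem]
  have key := PDiv.prod_sub_prod (fun i hi => (hs i (Finset.mem_of_mem_erase hi)).left)
    (fun i hi => (hs i (Finset.mem_of_mem_erase hi)).right)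
    (fun i hi => (hs i (Finset.mem_of_mem_erase hi)).diff)
    (s := (Finset.range (3 * q + 2)).erase (2 * q + 1))
  have key0 := PDiv.prod_zero (fun i hi => (hs i (Finset.mem_of_mem_erase hi)).left)
    (s := (Finset.range (3 * q + 2)).erase (2 * q + 1))
  have hdn := hd _ hmem
  have hen := he _ hmem
  rw [hn, show (p * (1 / 2) : ℚ) ^ 2 = 4 * (p ^ 2 / 16) by ring]
  generalize ((1 + (2 * q + 1 : ℕ) : ℚ)) ^ 2 = d at *
  generalize (p ^ 2 / 16 : ℚ) = w at *
  rw [show ∀ x y : ℚ, 3 / 4 * (4 * w / d * x) - (4 * w - w) / (d - w) * y =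
      (3 : ℕ) * w * (d⁻¹ - (d - w)⁻¹) * x + (3 : ℕ) * w / (d - w) * (x - y) by
    intros
    push_cast
    ring]
  have hw : PDiv p (0 + 2) ((3 : ℕ) * w) := (PDiv.natCast 3).mul h16
  have hi := PDiv.sub_inv (j := 2) hdn hen (by simpa using h16)
  exact ((hw.mul hi).mul key0).add ((hw.div hen).mul key)

theorem stmt_19 (p : ℕ) [Fact p.Prime] (hodd : Odd p) (hp4 : p % 4 = 3) :
    ‖(((∑ k ∈ Finset.range p,
        (6 * k + 1 : ℚ) * risingFac (1/2) k ^ 3 * risingFac (1/4) k ^ 2 /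
          (k.factorial : ℚ) ^ 5) -
        (3 * (p : ℚ) / 4) * risingFac (1/2) ((3 * p - 1) / 4) ^ 2 /
          (((((3 * p - 1) / 4).factorial : ℚ)) ^ 2) : ℚ) : ℚ_[p])‖ ≤
      (p : ℝ) ^ (-5 : ℤ) := by
  obtain ⟨q, hq⟩ : ∃ q, p = 4 * q + 3 := ⟨p / 4, by omega⟩
  have hN : (3 * p - 1) / 4 = 3 * q + 2 := by omega
  have hpq : (p : ℚ) = 4 * q + 3 := by exact_mod_cast hq
  have hsum := pDiv_sum_variation hp4 (n := 2 * q + 1) (by rw [hpq]; push_cast; ring)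
  have hB : ∀ j : ℕ, (1 + j : ℚ) ^ 2 - p ^ 2 / 4 / 4 ≠ 0 := fun j => by
    rw [show (p ^ 2 / 4 / 4 : ℚ) = (p / 4) ^ 2 by ring]
    exact sq_sub_sq_ne_zero (quarter_odd_ne_zero (2 * j - 2 * q) (by rw [hpq]; push_cast; ring))
      (by positivity)
  have h0 : ∀ j : ℕ, (1 + j : ℚ) ^ 2 - 0 / 4 ≠ 0 := fun j => by
    rw [zero_div, sub_zero]
    positivity
  have hterm (k : ℕ) : (6 * k + 1 : ℚ) * risingFac (1/2) k ^ 3 * risingFac (1/4) k ^ 2 /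
      (k.factorial : ℚ) ^ 5 = cFac k * uFac 0 k * vFac 0 k := by
    rw [cFac, uFac, vFac, zero_div, pairFac_zero_right, pairFac_zero_right, pairFac_zero_right,
      risingFac_one]
    ring
  have hprod : risingFac (1 / 2) (3 * q + 2) ^ 2 / ((3 * q + 2).factorial : ℚ) ^ 2 =
      ∏ j ∈ Finset.range (3 * q + 2), ((1 / 2 + j : ℚ) ^ 2 / (1 + j) ^ 2) := by
    rw [← risingFac_one, risingFac, risingFac, Finset.prod_div_distrib, Finset.prod_pow,
      Finset.prod_pow]
  have hU := sum_cFac_uFac_vFac_eq hq 0 h0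
  have hW := sum_cFac_uFac_vFac_eq hq _ hB
  have hV := sum_cFac_uFac_vFac_zero hq
  simp only [zero_div, sub_zero] at hU
  rw [show (p ^ 2 / 4 / 4 : ℚ) = p ^ 2 / 16 by ring] at hW
  have hP := (PDiv.mul (i := 0) (PDiv.natCast 3) (PDiv.prime (p := p))).mul (pDiv_prod_sub_prod hq)
  have hexp : ∑ k ∈ Finset.range p, cFac k * (uFac 0 k - uFac (p ^ 2 / 4) k) *
      (vFac 0 k - vFac (9 * p ^ 2 / 4) k) =
      ∑ k ∈ Finset.range p, cFac k * uFac 0 k * vFac 0 k -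
        ∑ k ∈ Finset.range p, cFac k * uFac 0 k * vFac (9 * p ^ 2 / 4) k -
        ∑ k ∈ Finset.range p, cFac k * uFac (p ^ 2 / 4) k * vFac 0 k +
        ∑ k ∈ Finset.range p, cFac k * uFac (p ^ 2 / 4) k * vFac (9 * p ^ 2 / 4) k := by
    rw [← Finset.sum_sub_distrib, ← Finset.sum_sub_distrib, ← Finset.sum_add_distrib]
    exact Finset.sum_congr rfl fun k _ => by ring
  rw [hU, hV, hW] at hexp
  rw [hN, mul_div_assoc, hprod, Finset.sum_congr rfl fun k _ => hterm k, zpow_neg, ← inv_zpow]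
  refine (congrArg (fun x : ℚ => ‖(x : ℚ_[p])‖) ?_).trans_le (hsum.add hP)
  rw [hexp]
  push_cast
  ring
end
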